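/- arXiv:1506.06081 — 3 statements merged into one kernel-verified Lean document; each statement's English description precedes it below -/
import Mathlib

section
/- Suppose Assumption A1 holds with parameter δ satisfying 0 < δ ≤ σ_r/(4√r). Let (v_1, λ_1), …, (v_r, λ_r) be the top r eigenpairs of M = (1/m) Σ_{i=1}^m b_i A_i ordered so that |λ_1| ≥ … ≥ |λ_r|, and set Z^0 = [z_1, …, z_r] with z_s = √(|λ_s|/2) v_s. Then d(Z^0, Z*) ≤ √((3/16) σ_r). -/
open Matrix MeasureTheory ProbabilityTheory Real
open scoped BigOperators ENNReal

noncomputable section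

/-- Frobenius norm of a real matrix. -/
def frobNorm {a b : ℕ} (M : Matrix (Fin a) (Fin b) ℝ) : ℝ :=
  Real.sqrt (∑ i, ∑ j, (M i j) ^ 2)

/-- Frobenius (trace) inner product `⟨M, N⟩ = trace (Mᵀ N)`. -/
def frobInner {a b : ℕ} (M N : Matrix (Fin a) (Fin b) ℝ) : ℝ :=
  ∑ i, ∑ j, M i j * N i j

/-- Operator (spectral) norm of a real square matrix. -/
def opNorm {n : ℕ} (M : Matrix (Fin n) (Fin n) ℝ) : ℝ :=
  ‖LinearMap.toContinuousLinearMap (Matrix.toEuclideanLin M)‖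

/-- An `r × r` real matrix is orthonormal if `U Uᵀ = Uᵀ U = I`. -/
def IsOrthoMat {r : ℕ} (U : Matrix (Fin r) (Fin r) ℝ) : Prop :=
  U * Uᵀ = 1 ∧ Uᵀ * U = 1

/-- The solution set `S̃ = {Z* U : U orthonormal}`. -/
def solSet {n r : ℕ} (Zstar : Matrix (Fin n) (Fin r) ℝ) : Set (Matrix (Fin n) (Fin r) ℝ) :=
  {Zt | ∃ U, IsOrthoMat U ∧ Zt = Zstar * U}

/-- The distance `d(Z, Z*) = min_{Z̃ ∈ S̃} ‖Z − Z̃‖_F`. -/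
def dSol {n r : ℕ} (Z Zstar : Matrix (Fin n) (Fin r) ℝ) : ℝ :=
  ⨅ Zt : solSet Zstar, frobNorm (Z - (Zt : Matrix (Fin n) (Fin r) ℝ))

/-- `Zbar` is a matrix in the solution set closest to `Z`. -/
def IsClosest {n r : ℕ} (Zstar Z Zbar : Matrix (Fin n) (Fin r) ℝ) : Prop :=
  Zbar ∈ solSet Zstar ∧ ∀ Zt ∈ solSet Zstar, frobNorm (Z - Zbar) ≤ frobNorm (Z - Zt)

/-- The gradient `∇f(Z) = (1/m) Σ_i (trace(Zᵀ A_i Z) − b_i) A_i Z`. -/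
def gradf {n r m : ℕ} (A : Fin m → Matrix (Fin n) (Fin n) ℝ) (b : Fin m → ℝ)
    (Z : Matrix (Fin n) (Fin r) ℝ) : Matrix (Fin n) (Fin r) ℝ :=
  (1 / (m : ℝ)) • ∑ i, (Matrix.trace (Zᵀ * A i * Z) - b i) • (A i * Z)

/-- Assumption A1 with parameter `δ`. -/
def AssumpA1 {n m : ℕ} (A : Fin m → Matrix (Fin n) (Fin n) ℝ) (σ1 : ℝ) (r : ℕ)
    (δ : ℝ) : Prop :=
  ∀ u : Fin n → ℝ, Real.sqrt (∑ i, u i ^ 2) ≤ Real.sqrt σ1 →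
    opNorm ((1 / (m : ℝ)) • ∑ i, (u ⬝ᵥ (A i).mulVec u) • A i - (2 : ℝ) • vecMulVec u u)
      ≤ δ / r

/-- Assumption A2 with parameter `δ`. -/
def AssumpA2 {n r m : ℕ} (A : Fin m → Matrix (Fin n) (Fin n) ℝ)
    (Zstar : Matrix (Fin n) (Fin r) ℝ) (δ : ℝ) : Prop :=
  ∀ Zt ∈ solSet Zstar, ∀ s k : Fin r,
    opNorm ((1 / (m : ℝ)) •
        ∑ i, (2 : ℝ) • (A i * vecMulVec (fun j => Zt j s) (fun j => Zt j k) * A i)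
      - ((2 * ((fun j => Zt j s) ⬝ᵥ fun j => Zt j k)) • (1 : Matrix (Fin n) (Fin n) ℝ)
          + (2 : ℝ) • vecMulVec (fun j => Zt j k) (fun j => Zt j s)))
      ≤ δ / r

lemma frobNorm_sq_eq {a b : ℕ} (H : Matrix (Fin a) (Fin b) ℝ) :
    ∑ i, ∑ j, (H i j) ^ 2 = Matrix.trace (Hᵀ * H) := by
  rw [Finset.sum_comm]
  simp [Matrix.trace, Matrix.mul_apply, sq]

lemma trace_sq_nonneg {a : ℕ} (H : Matrix (Fin a) (Fin a) ℝ) (h : Hᵀ = H) :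
    0 ≤ Matrix.trace (H * H) := by
  have := frobNorm_sq_eq H
  rw [h] at this
  rw [← this]
  positivity

/-- polar decomposition for invertible matrices -/
lemma exists_polar {r : ℕ} (B : Matrix (Fin r) (Fin r) ℝ) (hB : IsUnit B.det) :
    ∃ R, IsOrthoMat R ∧ (B * R).PosSemidef := by
  have hpsd : (B * Bᵀ).PosSemidef := by
    simpa using Matrix.posSemidef_self_mul_conjTranspose B
  open scoped MatrixOrder Matrix.Norms.L2Operator in
  obtain ⟨P, hP, hPP⟩ : ∃ P : Matrix (Fin r) (Fin r) ℝ, P.PosSemidef ∧ P * P = B * Bᵀ :=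
    ⟨CFC.sqrt (B * Bᵀ), (CFC.sqrt_nonneg _).posSemidef,
      CFC.sqrt_mul_sqrt_self _ hpsd.nonneg⟩
  have hPt : Pᵀ = P := by simpa using hP.1.eq
  have hBt : IsUnit (Bᵀ).det := by rwa [Matrix.det_transpose]
  have h1 : (B⁻¹ * P) * (B⁻¹ * P)ᵀ = 1 := by
    rw [Matrix.transpose_mul, hPt, Matrix.transpose_nonsing_inv]
    calc B⁻¹ * P * (P * Bᵀ⁻¹) = B⁻¹ * (P * P) * Bᵀ⁻¹ := by simp only [Matrix.mul_assoc]
      _ = (B⁻¹ * B) * (Bᵀ * Bᵀ⁻¹) := by rw [hPP]; simp only [Matrix.mul_assoc]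
      _ = 1 := by rw [Matrix.nonsing_inv_mul _ hB, Matrix.mul_nonsing_inv _ hBt, one_mul]
  refine ⟨B⁻¹ * P, ⟨h1, mul_eq_one_comm.mp h1⟩, ?_⟩
  rwa [← Matrix.mul_assoc, Matrix.mul_nonsing_inv _ hB, one_mul]

lemma procrustes {n r : ℕ} (U X : Matrix (Fin n) (Fin r) ℝ) (hP : (Uᵀ * X).PosSemidef)
    (s : ℝ) (hs : ((Xᵀ * X) - s • (1 : Matrix (Fin r) (Fin r) ℝ)).PosSemidef) :
    2 / 3 * s * Matrix.trace ((U - X)ᵀ * (U - X)) ≤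
      Matrix.trace ((U * Uᵀ - X * Xᵀ) * (U * Uᵀ - X * Xᵀ)) := by
  have hPt : Xᵀ * U = Uᵀ * X := by
    have := hP.1.eq
    simpa using this
  have key : ∀ (Q : Matrix (Fin r) (Fin r) ℝ), Q.PosSemidef →
      0 ≤ Matrix.trace ((U - X)ᵀ * (U - X) * Q) := by
    intro Q hQ
    have := (hQ.mul_mul_conjTranspose_same (U - X)).trace_nonneg
    rw [Matrix.trace_mul_comm, ← Matrix.mul_assoc] at this
    simpa using this
  have k1 := key _ hP
  have k2 := key _ hs
  have hh : (U - X)ᵀ * (U - X) = Uᵀ * U - Uᵀ * X - Uᵀ * X + Xᵀ * X := by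
    rw [Matrix.transpose_sub, Matrix.sub_mul, Matrix.mul_sub, Matrix.mul_sub, hPt]
    abel
  rw [Matrix.mul_sub, Matrix.trace_sub, Matrix.mul_smul, Matrix.trace_smul, Matrix.mul_one,
    smul_eq_mul] at k2
  have e1 : Matrix.trace ((U * Uᵀ - X * Xᵀ) * (U * Uᵀ - X * Xᵀ)) =
      Matrix.trace ((Uᵀ * U) * (Uᵀ * U)) - 2 * Matrix.trace ((Uᵀ * X) * (Uᵀ * X))
        + Matrix.trace ((Xᵀ * X) * (Xᵀ * X)) := by
    have a1 : Matrix.trace (U * Uᵀ * (U * Uᵀ)) = Matrix.trace ((Uᵀ * U) * (Uᵀ * U)) := by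
      rw [Matrix.mul_assoc, Matrix.trace_mul_comm]; simp only [Matrix.mul_assoc]
    have a2 : Matrix.trace (U * Uᵀ * (X * Xᵀ)) = Matrix.trace ((Uᵀ * X) * (Uᵀ * X)) := by
      have : Uᵀ * (X * Xᵀ) * U = (Uᵀ * X) * (Xᵀ * U) := by simp only [Matrix.mul_assoc]
      rw [Matrix.mul_assoc, Matrix.trace_mul_comm, this, hPt]
    have a3 : Matrix.trace (X * Xᵀ * (U * Uᵀ)) = Matrix.trace ((Uᵀ * X) * (Uᵀ * X)) := by
      rw [Matrix.trace_mul_comm, a2]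
    have a4 : Matrix.trace (X * Xᵀ * (X * Xᵀ)) = Matrix.trace ((Xᵀ * X) * (Xᵀ * X)) := by
      rw [Matrix.mul_assoc, Matrix.trace_mul_comm]; simp only [Matrix.mul_assoc]
    rw [Matrix.sub_mul, Matrix.mul_sub, Matrix.mul_sub]
    simp only [Matrix.trace_sub, a1, a2, a3, a4]
    ring
  have hat : (Uᵀ * U)ᵀ = Uᵀ * U := by simp
  have hgt : (Xᵀ * X)ᵀ = Xᵀ * X := by simp
  have hpt : (Uᵀ * X)ᵀ = Uᵀ * X := by simp [hPt]
  rw [hh] at k1 k2 ⊢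
  rw [e1]
  generalize Uᵀ * U = a at *
  generalize Uᵀ * X = p at *
  generalize Xᵀ * X = g at *
  have q1 := trace_sq_nonneg ((a - p - p + g) + (4 / 3 : ℝ) • (p - g)) (by
    simp [hat, hgt, hpt])
  have q2 := trace_sq_nonneg (p - g) (by simp [hgt, hpt])
  simp only [Matrix.add_mul, Matrix.mul_add, Matrix.sub_mul, Matrix.mul_sub, Matrix.trace_add,
    Matrix.trace_sub, Matrix.smul_mul, Matrix.mul_smul, Matrix.trace_smul, smul_eq_mul,
    Matrix.trace_mul_comm g a, Matrix.trace_mul_comm g p, Matrix.trace_mul_comm p a, smul_sub] at q1 q2 k1 k2 ⊢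
  linarith

lemma frob_le_of_rank {n k : ℕ} (E : Matrix (Fin n) (Fin n) ℝ) (hE : Eᵀ = E) (hk : E.rank ≤ k)
    (d : ℝ) (hd : ∀ w, (E *ᵥ w) ⬝ᵥ (E *ᵥ w) ≤ d ^ 2 * (w ⬝ᵥ w)) :
    Matrix.trace (E * E) ≤ k * d ^ 2 := by
  have hH : E.IsHermitian := by simpa [Matrix.IsHermitian] using hE
  have hev : ∀ i, hH.eigenvalues i ^ 2 ≤ d ^ 2 := by
    intro i
    have h := hd (hH.eigenvectorBasis i).ofLp
    rw [hH.mulVec_eigenvectorBasis] at h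
    have h1 : (hH.eigenvectorBasis i).ofLp ⬝ᵥ (hH.eigenvectorBasis i).ofLp = 1 := by
      have := hH.eigenvectorBasis.orthonormal.1 i
      rw [EuclideanSpace.norm_eq, Real.sqrt_eq_one] at this
      simpa [dotProduct, sq] using this
    simp only [dotProduct_smul, smul_dotProduct, h1, smul_eq_mul] at h
    nlinarith
  have htr : Matrix.trace (E * E) = ∑ i, hH.eigenvalues i ^ 2 := by
    have h1 : (hH.eigenvectorUnitary : Matrix (Fin n) (Fin n) ℝ)ᴴ * hH.eigenvectorUnitary = 1 :=
      Unitary.coe_star_mul_self hH.eigenvectorUnitary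
    have h2 := hH.spectral_theorem
    rw [Unitary.conjStarAlgAut_apply, Matrix.star_eq_conjTranspose] at h2
    generalize (hH.eigenvectorUnitary : Matrix (Fin n) (Fin n) ℝ) = Q at h1 h2
    generalize hH.eigenvalues = l at h1 h2
    rw [h2]
    calc _ = Matrix.trace (Q * (diagonal (RCLike.ofReal ∘ l) * (Qᴴ * Q) * diagonal (RCLike.ofReal ∘ l) * Qᴴ)) := by
          simp only [Matrix.mul_assoc]
      _ = Matrix.trace (diagonal (RCLike.ofReal ∘ l) * (Qᴴ * Q) * diagonal (RCLike.ofReal ∘ l) * (Qᴴ * Q)) := by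
          rw [Matrix.trace_mul_comm]; simp only [Matrix.mul_assoc]
      _ = _ := by
          rw [h1]; simp [Matrix.trace, sq]
  rw [htr]
  have hc := hH.rank_eq_card_non_zero_eigs
  rw [Fintype.card_subtype] at hc
  calc ∑ i, hH.eigenvalues i ^ 2 = ∑ i with hH.eigenvalues i ≠ 0, hH.eigenvalues i ^ 2 := by
        rw [Finset.sum_filter]
        refine Finset.sum_congr rfl fun i _ => ?_
        split_ifs with h
        · rfl
        · simp at h; simp [h]
    _ ≤ ∑ i with hH.eigenvalues i ≠ 0, d ^ 2 := Finset.sum_le_sum fun i _ => hev i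
    _ = E.rank * d ^ 2 := by rw [Finset.sum_const, nsmul_eq_mul, ← hc]
    _ ≤ k * d ^ 2 := by gcongr

lemma norm_toLp_sq {n : ℕ} (w : Fin n → ℝ) : ‖WithLp.toLp 2 w‖ ^ 2 = w ⬝ᵥ w := by
  rw [EuclideanSpace.norm_eq, Real.sq_sqrt (by positivity)]
  simp [dotProduct, sq]

lemma opNorm_mulVec {n : ℕ} (M : Matrix (Fin n) (Fin n) ℝ) (c : ℝ) (h : opNorm M ≤ c)
    (w : Fin n → ℝ) : (M *ᵥ w) ⬝ᵥ (M *ᵥ w) ≤ c ^ 2 * (w ⬝ᵥ w) := by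
  have h1 := (LinearMap.toContinuousLinearMap (Matrix.toEuclideanLin M)).le_opNorm (WithLp.toLp 2 w)
  have h2 : ‖WithLp.toLp 2 (M *ᵥ w)‖ ≤ c * ‖WithLp.toLp 2 w‖ := by
    refine le_trans ?_ (le_trans h1 ?_)
    · simp [Matrix.toEuclideanLin]
    · gcongr; exact h
  rw [← norm_toLp_sq, ← norm_toLp_sq, ← mul_pow]
  gcongr

lemma opNorm_sum_le {n k : ℕ} (N : Fin k → Matrix (Fin n) (Fin n) ℝ) :
    opNorm (∑ s, N s) ≤ ∑ s, opNorm (N s) := by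
  unfold opNorm
  rw [map_sum, map_sum]
  exact norm_sum_le _ _

lemma dot_abs_le {n : ℕ} (w x : Fin n → ℝ) (c : ℝ) (hc : 0 ≤ c)
    (h : x ⬝ᵥ x ≤ c ^ 2 * (w ⬝ᵥ w)) : |w ⬝ᵥ x| ≤ c * (w ⬝ᵥ w) := by
  have h0 : 0 ≤ w ⬝ᵥ w := by rw [← norm_toLp_sq]; positivity
  apply abs_le_of_sq_le_sq _ (by positivity)
  have cs : (w ⬝ᵥ x) ^ 2 ≤ (w ⬝ᵥ w) * (x ⬝ᵥ x) := by
    have := Finset.sum_mul_sq_le_sq_mul_sq Finset.univ w x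
    simpa [dotProduct, sq] using this
  nlinarith

/-- triangle inequality in dot-product form (halved) -/
lemma dot_half_add {n : ℕ} (x y : Fin n → ℝ) (c : ℝ) (hx : x ⬝ᵥ x ≤ c) (hy : y ⬝ᵥ y ≤ c) :
    ((1 / 2 : ℝ) • (x + y)) ⬝ᵥ ((1 / 2 : ℝ) • (x + y)) ≤ c := by
  have h0 : 0 ≤ (x - y) ⬝ᵥ (x - y) := by rw [← norm_toLp_sq]; positivity
  simp only [sub_dotProduct, dotProduct_sub, dotProduct_smul, smul_dotProduct, add_dotProduct,
    dotProduct_add, smul_eq_mul, dotProduct_comm y x] at *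
  linarith

lemma parseval {n : ℕ} (v : Fin n → Fin n → ℝ)
    (horth : ∀ i j : Fin n, v i ⬝ᵥ v j = if i = j then (1 : ℝ) else 0) (w : Fin n → ℝ) :
    w ⬝ᵥ w = ∑ i, (v i ⬝ᵥ w) ^ 2 := by
  have h1 : (Matrix.of v) * (Matrix.of v)ᵀ = 1 := by
    ext i j
    simpa [Matrix.mul_apply, dotProduct, Matrix.one_apply] using horth i j
  have h2 : (Matrix.of v)ᵀ * (Matrix.of v) = 1 := mul_eq_one_comm.mp h1
  have h3 : ((Matrix.of v) *ᵥ w) ⬝ᵥ ((Matrix.of v) *ᵥ w) = w ⬝ᵥ w := by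
    rw [Matrix.dotProduct_mulVec, Matrix.vecMul_mulVec, h2, Matrix.vecMul_one]
  rw [← h3]
  simp [dotProduct, Matrix.mulVec, sq]

lemma opNorm_D {n r m : ℕ} (hr : 0 < r)
    (A : Fin m → Matrix (Fin n) (Fin n) ℝ)
    (Z : Matrix (Fin n) (Fin r) ℝ)
    (sig : Fin r → ℝ) (hmono : ∀ s t : Fin r, s ≤ t → sig t ≤ sig s)
    (hG : Zᵀ * Z = Matrix.diagonal sig)
    (b : Fin m → ℝ) (hb : ∀ i, b i = Matrix.trace (A i * (Z * Zᵀ)))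
    (δ : ℝ) (hA1 : AssumpA1 A (sig ⟨0, hr⟩) r δ) :
    opNorm ((1 / (m : ℝ)) • ∑ k, (b k) • A k - (2 : ℝ) • (Z * Zᵀ)) ≤ δ := by
  have hX : Z * Zᵀ = ∑ s, vecMulVec (fun i => Z i s) (fun i => Z i s) := by
    ext i j
    simp [Matrix.mul_apply, Matrix.sum_apply, vecMulVec_apply]
  have hbk : ∀ k, b k = ∑ s, ((fun i => Z i s) ⬝ᵥ (A k).mulVec (fun i => Z i s)) := by
    intro k
    rw [hb, ← Matrix.mul_assoc, Matrix.trace_mul_comm]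
    simp only [Matrix.trace, Matrix.diag, Matrix.mul_apply (M := Zᵀ)]
    simp [dotProduct, Matrix.mulVec, Matrix.mul_apply]
  have hM : (1 / (m : ℝ)) • ∑ k, (b k) • A k - (2 : ℝ) • (Z * Zᵀ) =
      ∑ s, ((1 / (m : ℝ)) • ∑ k, ((fun i => Z i s) ⬝ᵥ (A k).mulVec (fun i => Z i s)) • A k
        - (2 : ℝ) • vecMulVec (fun i => Z i s) (fun i => Z i s)) := by
    rw [Finset.sum_sub_distrib, ← Finset.smul_sum, ← Finset.smul_sum, ← hX, Finset.sum_comm]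
    simp only [hbk, Finset.sum_smul]
  rw [hM]
  refine (opNorm_sum_le _).trans ?_
  calc _ ≤ ∑ s : Fin r, δ / r := by
        refine Finset.sum_le_sum fun s _ => hA1 _ ?_
        apply Real.sqrt_le_sqrt
        have := congrFun (congrFun hG s) s
        simp [Matrix.mul_apply] at this
        calc _ = sig s := by rw [← this]; simp [sq]
          _ ≤ _ := hmono _ _ (by simp [Fin.le_def])
    _ = δ := by
        have : (r : ℝ) ≠ 0 := by positivity
        simp; field_simp

lemma eig_dot {n : ℕ} (M : Matrix (Fin n) (Fin n) ℝ) (hM : Mᵀ = M) (lam : ℝ) (v : Fin n → ℝ)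
    (h : M *ᵥ v = lam • v) (w : Fin n → ℝ) : v ⬝ᵥ (M *ᵥ w) = lam * (v ⬝ᵥ w) := by
  rw [Matrix.dotProduct_mulVec, ← Matrix.mulVec_transpose, hM, h, smul_dotProduct, smul_eq_mul]

lemma dot_self_nonneg' {n : ℕ} (w : Fin n → ℝ) : 0 ≤ w ⬝ᵥ w := by
  rw [← norm_toLp_sq]; positivity

lemma tail_bound {n r : ℕ} (M : Matrix (Fin n) (Fin n) ℝ)
    (Z : Matrix (Fin n) (Fin r) ℝ) (δ : ℝ) (hδ : 0 ≤ δ)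
    (hD : ∀ w, ((M - (2 : ℝ) • (Z * Zᵀ)) *ᵥ w) ⬝ᵥ ((M - (2 : ℝ) • (Z * Zᵀ)) *ᵥ w)
      ≤ δ ^ 2 * (w ⬝ᵥ w))
    (hM : Mᵀ = M)
    (lam : Fin n → ℝ) (v : Fin n → Fin n → ℝ)
    (horth : ∀ i j : Fin n, v i ⬝ᵥ v j = if i = j then (1 : ℝ) else 0)
    (heig : ∀ i, M.mulVec (v i) = lam i • v i)
    (hsort : ∀ i j : Fin n, i ≤ j → |lam j| ≤ |lam i|)
    (i : Fin n) (hi : r ≤ i) : |lam i| ≤ δ := by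
  have hrn : r + 1 ≤ n := by omega
  -- columns `v_0, …, v_r`
  let W : Matrix (Fin n) (Fin (r + 1)) ℝ := Matrix.of fun k j => v (Fin.castLE hrn j) k
  have hker : LinearMap.ker (Matrix.mulVecLin (Zᵀ * W)) ≠ ⊥ :=
    LinearMap.ker_ne_bot_of_finrank_lt (by simp)
  obtain ⟨c, hc, hc0⟩ := Submodule.exists_mem_ne_zero_of_ne_bot hker
  rw [LinearMap.mem_ker, Matrix.mulVecLin_apply, ← Matrix.mulVec_mulVec] at hc
  set w := W *ᵥ c with hw
  have hvw : ∀ k : Fin n, v k ⬝ᵥ w = if h : (k : ℕ) < r + 1 then c ⟨k, h⟩ else 0 := by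
    intro k
    have : v k ⬝ᵥ w = ∑ j, (v k ⬝ᵥ v (Fin.castLE hrn j)) * c j := by
      rw [hw, Matrix.dotProduct_mulVec]
      rfl
    rw [this]
    simp only [horth]
    split_ifs with h
    · rw [Finset.sum_eq_single ⟨k, h⟩]
      · simp
      · intro b _ hb
        have : k ≠ Fin.castLE hrn b := by
          rintro rfl; exact hb (by ext; simp)
        simp [this]
      · simp
    · apply Finset.sum_eq_zero
      intro b _
      have : k ≠ Fin.castLE hrn b := by
        rintro rfl; exact h b.2
      simp [this]
  have hMw : (M - (2 : ℝ) • (Z * Zᵀ)) *ᵥ w = M *ᵥ w := by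
    rw [Matrix.sub_mulVec, Matrix.smul_mulVec, ← Matrix.mulVec_mulVec, hc]; simp
  have h1 := hD w
  rw [hMw, parseval v horth (M *ᵥ w)] at h1
  have h2 : lam i ^ 2 * (w ⬝ᵥ w) ≤ ∑ k, (v k ⬝ᵥ M *ᵥ w) ^ 2 := by
    rw [parseval v horth w, Finset.mul_sum]
    refine Finset.sum_le_sum fun k _ => ?_
    rw [eig_dot M hM _ _ (heig k), mul_pow]
    by_cases h : (k : ℕ) < r + 1
    · have := hsort k i (by rw [Fin.le_def]; omega)
      have := sq_le_sq.mpr this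
      gcongr
    · simp [hvw, h]
  have hpos : 0 < w ⬝ᵥ w := by
    rw [parseval v horth w]
    obtain ⟨j, hj⟩ := Function.ne_iff.mp hc0
    refine Finset.sum_pos' (fun _ _ => sq_nonneg _) ⟨Fin.castLE hrn j, Finset.mem_univ _, ?_⟩
    have : v (Fin.castLE hrn j) ⬝ᵥ w = c j := by rw [hvw, dif_pos (by exact j.2)]; rfl
    rw [this]
    have : c j ≠ 0 := hj
    positivity
  exact abs_le_of_sq_le_sq (le_of_mul_le_mul_right (h2.trans h1) hpos) hδ

/-- quadratic form facts for `w = Z y` when the Gram matrix is diagonal -/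
lemma quad_facts {n r : ℕ} (Z : Matrix (Fin n) (Fin r) ℝ) (sig : Fin r → ℝ) (σ : ℝ) (hσ : 0 < σ)
    (hsig : ∀ s, σ ≤ sig s) (hG : Zᵀ * Z = Matrix.diagonal sig) (y : Fin r → ℝ) (hy : y ≠ 0) :
    0 < (Z *ᵥ y) ⬝ᵥ (Z *ᵥ y) ∧
    σ * ((Z *ᵥ y) ⬝ᵥ (Z *ᵥ y)) ≤ (Z *ᵥ y) ⬝ᵥ ((Z * Zᵀ) *ᵥ (Z *ᵥ y)) := by
  have e1 : (Z *ᵥ y) ⬝ᵥ (Z *ᵥ y) = ∑ s, sig s * y s ^ 2 := by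
    rw [Matrix.dotProduct_mulVec, Matrix.vecMul_mulVec, hG]
    simp only [dotProduct, Matrix.vecMul_diagonal]
    refine Finset.sum_congr rfl fun s _ => by ring
  have e2 : (Z *ᵥ y) ⬝ᵥ ((Z * Zᵀ) *ᵥ (Z *ᵥ y)) = ∑ s, sig s ^ 2 * y s ^ 2 := by
    have : (Z * Zᵀ) *ᵥ (Z *ᵥ y) = Z *ᵥ (Matrix.diagonal sig *ᵥ y) := by
      rw [← hG]; simp only [Matrix.mulVec_mulVec, Matrix.mul_assoc]
    rw [this, Matrix.dotProduct_mulVec, Matrix.vecMul_mulVec, hG]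
    simp only [dotProduct, Matrix.vecMul_diagonal, Matrix.mulVec_diagonal]
    refine Finset.sum_congr rfl fun s _ => by ring
  constructor
  · rw [e1]
    obtain ⟨j, hj⟩ := Function.ne_iff.mp hy
    have hj' : y j ≠ 0 := hj
    refine Finset.sum_pos' (fun s _ => ?_) ⟨j, Finset.mem_univ _, ?_⟩
    · have : 0 < sig s := hσ.trans_le (hsig s)
      positivity
    · have : 0 < sig j := hσ.trans_le (hsig j)
      positivity
  · rw [e1, e2, Finset.mul_sum]
    refine Finset.sum_le_sum fun s _ => ?_
    have := hsig s
    have := sq_nonneg (y s)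
    have : 0 < sig s := by linarith
    rw [sq (sig s), ← mul_assoc]
    gcongr

lemma head_bound {n r : ℕ} (M : Matrix (Fin n) (Fin n) ℝ)
    (Z : Matrix (Fin n) (Fin r) ℝ) (sig : Fin r → ℝ) (σ : ℝ) (hσ : 0 < σ)
    (hsig : ∀ s, σ ≤ sig s) (hG : Zᵀ * Z = Matrix.diagonal sig)
    (δ : ℝ) (hδ : 0 ≤ δ) (hδσ : δ < σ)
    (hD : ∀ w, ((M - (2 : ℝ) • (Z * Zᵀ)) *ᵥ w) ⬝ᵥ ((M - (2 : ℝ) • (Z * Zᵀ)) *ᵥ w)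
      ≤ δ ^ 2 * (w ⬝ᵥ w))
    (hM : Mᵀ = M)
    (lam : Fin n → ℝ) (v : Fin n → Fin n → ℝ)
    (horth : ∀ i j : Fin n, v i ⬝ᵥ v j = if i = j then (1 : ℝ) else 0)
    (heig : ∀ i, M.mulVec (v i) = lam i • v i)
    (hsort : ∀ i j : Fin n, i ≤ j → |lam j| ≤ |lam i|)
    (i : Fin n) (hi : (i : ℕ) < r) : 0 ≤ lam i := by
  by_contra hneg
  push Not at hneg
  have quad : ∀ w, 2 * (w ⬝ᵥ ((Z * Zᵀ) *ᵥ w)) - δ * (w ⬝ᵥ w) ≤ w ⬝ᵥ (M *ᵥ w) := by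
    intro w
    have h := (abs_le.mp (dot_abs_le w _ δ hδ (hD w))).1
    rw [Matrix.sub_mulVec, Matrix.smul_mulVec, dotProduct_sub, dotProduct_smul, smul_eq_mul] at h
    linarith
  have hli : |lam i| ≤ δ := by
    have h := quad (v i)
    rw [heig, dotProduct_smul, horth] at h
    have h0 : 0 ≤ v i ⬝ᵥ ((Z * Zᵀ) *ᵥ v i) := by
      have : v i ⬝ᵥ ((Z * Zᵀ) *ᵥ v i) = (Zᵀ *ᵥ v i) ⬝ᵥ (Zᵀ *ᵥ v i) := by
        rw [← Matrix.mulVec_mulVec, Matrix.dotProduct_mulVec, ← Matrix.mulVec_transpose]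
      rw [this]; exact dot_self_nonneg' _
    simp at h
    rw [abs_of_neg hneg]; linarith
  let W : Matrix (Fin i) (Fin n) ℝ := Matrix.of fun j k => v (Fin.castLE i.2.le j) k
  have hker : LinearMap.ker (Matrix.mulVecLin (W * Z)) ≠ ⊥ :=
    LinearMap.ker_ne_bot_of_finrank_lt (by simpa using hi)
  obtain ⟨y, hy, hy0⟩ := Submodule.exists_mem_ne_zero_of_ne_bot hker
  rw [LinearMap.mem_ker, Matrix.mulVecLin_apply, ← Matrix.mulVec_mulVec] at hy
  obtain ⟨q1, q2⟩ := quad_facts Z sig σ hσ hsig hG y hy0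
  have h3 := quad (Z *ᵥ y)
  set w := Z *ᵥ y with hw
  have hvw : ∀ k : Fin n, k < i → v k ⬝ᵥ w = 0 := by
    intro k hk
    exact congrFun hy ⟨k, hk⟩
  have h4 : w ⬝ᵥ (M *ᵥ w) ≤ δ * (w ⬝ᵥ w) := by
    refine (le_abs_self _).trans (dot_abs_le w _ δ hδ ?_)
    rw [parseval v horth w, parseval v horth (M *ᵥ w), Finset.mul_sum]
    refine Finset.sum_le_sum fun k _ => ?_
    rw [eig_dot M hM _ _ (heig k), mul_pow]
    by_cases h : k < i
    · simp [hvw k h]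
    · have := (hsort i k (not_lt.mp h)).trans hli
      have : lam k ^ 2 ≤ δ ^ 2 := sq_le_sq.mpr (this.trans (le_abs_self _))
      gcongr
  nlinarith

lemma E_bound {n r : ℕ} (hrn : r ≤ n) (M : Matrix (Fin n) (Fin n) ℝ)
    (Z Z0 : Matrix (Fin n) (Fin r) ℝ) (δ : ℝ)
    (hD : ∀ w, ((M - (2 : ℝ) • (Z * Zᵀ)) *ᵥ w) ⬝ᵥ ((M - (2 : ℝ) • (Z * Zᵀ)) *ᵥ w)
      ≤ δ ^ 2 * (w ⬝ᵥ w))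
    (hM : Mᵀ = M)
    (lam : Fin n → ℝ) (v : Fin n → Fin n → ℝ)
    (horth : ∀ i j : Fin n, v i ⬝ᵥ v j = if i = j then (1 : ℝ) else 0)
    (heig : ∀ i, M.mulVec (v i) = lam i • v i)
    (htail : ∀ i : Fin n, r ≤ i → |lam i| ≤ δ)
    (hhead : ∀ i : Fin n, (i : ℕ) < r → 0 ≤ lam i)
    (hZ0 : ∀ (i : Fin n) (s : Fin r),
      Z0 i s = Real.sqrt (|lam (Fin.castLE hrn s)| / 2) * v (Fin.castLE hrn s) i)
    (w : Fin n → ℝ) :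
    ((Z0 * Z0ᵀ - Z * Zᵀ) *ᵥ w) ⬝ᵥ ((Z0 * Z0ᵀ - Z * Zᵀ) *ᵥ w) ≤ δ ^ 2 * (w ⬝ᵥ w) := by
  have hvZ : ∀ k : Fin n, v k ⬝ᵥ ((Z0 * Z0ᵀ) *ᵥ w) =
      if (k : ℕ) < r then lam k / 2 * (v k ⬝ᵥ w) else 0 := by
    intro k
    have hcol : ∀ (x : Fin n → ℝ) (s : Fin r), (x ᵥ* Z0) s =
        Real.sqrt (|lam (Fin.castLE hrn s)| / 2) * (v (Fin.castLE hrn s) ⬝ᵥ x) := by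
      intro x s
      simp only [Matrix.vecMul, dotProduct, hZ0, Finset.mul_sum]
      refine Finset.sum_congr rfl fun _ _ => by ring
    have : v k ⬝ᵥ ((Z0 * Z0ᵀ) *ᵥ w) = ∑ s, (v k ᵥ* Z0) s * (w ᵥ* Z0) s := by
      rw [← Matrix.mulVec_mulVec, Matrix.dotProduct_mulVec, Matrix.mulVec_transpose]
      rfl
    rw [this]
    simp only [hcol, horth]
    split_ifs with h
    · rw [Finset.sum_eq_single ⟨k, h⟩]
      · have e : Fin.castLE hrn ⟨k, h⟩ = k := by ext; simp
        rw [e, if_pos rfl, abs_of_nonneg (hhead k h)]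
        have := hhead k h
        have hs := Real.mul_self_sqrt (show 0 ≤ lam k / 2 by positivity)
        rw [mul_one, ← mul_assoc, hs]
      · intro b _ hb
        have : Fin.castLE hrn b ≠ k := by
          rintro rfl; exact hb (by ext; simp)
        simp [this]
      · simp
    · apply Finset.sum_eq_zero
      intro b _
      have : Fin.castLE hrn b ≠ k := by
        rintro rfl; exact h (by simp)
      simp [this]
  have hN : (((2 : ℝ) • (Z0 * Z0ᵀ) - M) *ᵥ w) ⬝ᵥ (((2 : ℝ) • (Z0 * Z0ᵀ) - M) *ᵥ w)
      ≤ δ ^ 2 * (w ⬝ᵥ w) := by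
    rw [parseval v horth w, parseval v horth (_ *ᵥ w), Finset.mul_sum]
    refine Finset.sum_le_sum fun k _ => ?_
    rw [Matrix.sub_mulVec, Matrix.smul_mulVec, dotProduct_sub, dotProduct_smul,
      eig_dot M hM _ _ (heig k), hvZ, smul_eq_mul]
    split_ifs with h
    · have : 2 * (lam k / 2 * (v k ⬝ᵥ w)) - lam k * (v k ⬝ᵥ w) = 0 := by ring
      rw [this, zero_pow two_ne_zero]
      exact mul_nonneg (sq_nonneg _) (sq_nonneg _)
    · have : lam k ^ 2 ≤ δ ^ 2 := sq_le_sq.mpr ((htail k (not_lt.mp h)).trans (le_abs_self _))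
      have e : (2 * 0 - lam k * (v k ⬝ᵥ w)) ^ 2 = lam k ^ 2 * (v k ⬝ᵥ w) ^ 2 := by ring
      rw [e]; gcongr
  have := dot_half_add _ _ _ hN (hD w)
  have e : (1 / 2 : ℝ) • (((2 : ℝ) • (Z0 * Z0ᵀ) - M) *ᵥ w + (M - (2 : ℝ) • (Z * Zᵀ)) *ᵥ w) =
      (Z0 * Z0ᵀ - Z * Zᵀ) *ᵥ w := by
    rw [← Matrix.add_mulVec, ← Matrix.smul_mulVec]
    congr 1
    ext i j
    simp
    ring
  rwa [e] at this

lemma finish {n r : ℕ} (hr : 0 < r) (Z Z0 : Matrix (Fin n) (Fin r) ℝ)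
    (sig : Fin r → ℝ) (σ : ℝ) (hσ : 0 < σ)
    (hsig : ∀ s, σ ≤ sig s) (hG : Zᵀ * Z = Matrix.diagonal sig)
    (δ : ℝ) (hδ : 0 ≤ δ) (hδσ : δ < σ) (hδ2 : 2 * r * δ ^ 2 ≤ σ ^ 2 / 8)
    (hE : ∀ w, ((Z0 * Z0ᵀ - Z * Zᵀ) *ᵥ w) ⬝ᵥ ((Z0 * Z0ᵀ - Z * Zᵀ) *ᵥ w) ≤ δ ^ 2 * (w ⬝ᵥ w)) :
    ∃ R, IsOrthoMat R ∧ Matrix.trace ((Z0 - Z * R)ᵀ * (Z0 - Z * R)) ≤ 3 / 16 * σ := by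
  have hB : IsUnit (Z0ᵀ * Z).det := by
    rw [isUnit_iff_ne_zero]
    intro h0
    obtain ⟨y, hy0, hy⟩ := Matrix.exists_mulVec_eq_zero_iff.mpr h0
    obtain ⟨q1, q2⟩ := quad_facts Z sig σ hσ hsig hG y hy0
    have h := (abs_le.mp (dot_abs_le (Z *ᵥ y) _ δ hδ (hE (Z *ᵥ y)))).1
    rw [← Matrix.mulVec_mulVec] at hy
    rw [Matrix.sub_mulVec, dotProduct_sub, ← Matrix.mulVec_mulVec (Z *ᵥ y) Z0, hy] at h
    simp only [Matrix.mulVec_zero, dotProduct_zero] at h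
    nlinarith
  obtain ⟨R, hR, hP⟩ := exists_polar _ hB
  refine ⟨R, hR, ?_⟩
  have hXX : (Z * R) * (Z * R)ᵀ = Z * Zᵀ := by
    rw [Matrix.transpose_mul]
    calc Z * R * (Rᵀ * Zᵀ) = Z * (R * Rᵀ) * Zᵀ := by simp only [Matrix.mul_assoc]
      _ = _ := by rw [hR.1, Matrix.mul_one]
  have hs : ((Z * R)ᵀ * (Z * R) - σ • (1 : Matrix (Fin r) (Fin r) ℝ)).PosSemidef := by
    have hd : (Matrix.diagonal (fun s => sig s - σ)).PosSemidef :=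
      Matrix.PosSemidef.diagonal (fun s => sub_nonneg.mpr (hsig s))
    have := hd.conjTranspose_mul_mul_same R
    convert this using 1
    have e : Matrix.diagonal (fun s => sig s - σ) = Zᵀ * Z - σ • 1 := by
      rw [hG]; ext i j; by_cases h : i = j <;> simp [h, Matrix.one_apply]
    rw [e, Matrix.mul_sub, Matrix.sub_mul, Matrix.mul_smul, Matrix.smul_mul, Matrix.mul_one]
    rw [show Rᴴ = Rᵀ by simp, hR.2, Matrix.transpose_mul]
    simp only [Matrix.mul_assoc]
  have h1 := procrustes Z0 (Z * R) (by rwa [← Matrix.mul_assoc]) σ hs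
  rw [hXX] at h1
  have hrank : (Z0 * Z0ᵀ - Z * Zᵀ).rank ≤ 2 * r := by
    have : Z0 * Z0ᵀ - Z * Zᵀ = Matrix.fromCols Z0 Z * Matrix.fromRows Z0ᵀ (-Zᵀ) := by
      rw [Matrix.fromCols_mul_fromRows, Matrix.mul_neg, sub_eq_add_neg]
    rw [this]
    refine (Matrix.rank_mul_le_left _ _).trans ((Matrix.rank_le_card_width _).trans ?_)
    simp; omega
  have h2 := frob_le_of_rank _ (by simp) hrank δ hE
  push_cast at h2
  have h3 : σ * (2 / 3 * Matrix.trace ((Z0 - Z * R)ᵀ * (Z0 - Z * R))) ≤ σ * (σ / 8) := by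
    linarith
  have h4 := le_of_mul_le_mul_left h3 hσ
  have aux : ∀ t : ℝ, 2 / 3 * t ≤ σ / 8 → t ≤ 3 / 16 * σ := fun t ht => by linarith
  exact aux _ h4

theorem spectral_initialization_bound {n r m : ℕ} (hr : 0 < r) (hrn : r ≤ n)
    (A : Fin m → Matrix (Fin n) (Fin n) ℝ) (hAsym : ∀ i, (A i).IsSymm)
(Zstar : Matrix (Fin n) (Fin r) ℝ)
    (sig : Fin r → ℝ) (hpos : ∀ s, 0 < sig s)
    (hmono : ∀ s t : Fin r, s ≤ t → sig t ≤ sig s)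
    (hspec : ∃ V, IsOrthoMat V ∧ Zstarᵀ * Zstar = V * Matrix.diagonal sig * Vᵀ)
    (b : Fin m → ℝ) (hb : ∀ i, b i = Matrix.trace (A i * (Zstar * Zstarᵀ)))
    (δ : ℝ) (hδ0 : 0 < δ)
    (hδ : δ ≤ (sig ⟨r - 1, Nat.sub_lt hr Nat.one_pos⟩) / (4 * Real.sqrt r))
    (hA1 : AssumpA1 A (sig ⟨0, hr⟩) r δ)
    -- eigendecomposition of M = (1/m) Σ_i b_i A_i, ordered by decreasing |λ|
    (lam : Fin n → ℝ) (v : Fin n → Fin n → ℝ)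
    (horth : ∀ i j : Fin n, v i ⬝ᵥ v j = if i = j then (1 : ℝ) else 0)
    (heig : ∀ i, ((1 / (m : ℝ)) • ∑ k, (b k) • A k).mulVec (v i) = lam i • v i)
    (hsort : ∀ i j : Fin n, i ≤ j → |lam j| ≤ |lam i|)
    -- spectral initialization: columns z_s = √(|λ_s|/2) v_s
    (Z0 : Matrix (Fin n) (Fin r) ℝ)
    (hZ0 : ∀ (i : Fin n) (s : Fin r),
      Z0 i s = Real.sqrt (|lam (Fin.castLE hrn s)| / 2) * v (Fin.castLE hrn s) i) :
    dSol Z0 Zstar ≤ Real.sqrt (3 / 16 * (sig ⟨r - 1, Nat.sub_lt hr Nat.one_pos⟩)) := by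

  obtain ⟨V, hV, hGV⟩ := hspec
  set σ := sig ⟨r - 1, Nat.sub_lt hr Nat.one_pos⟩ with hσdef
  have hσ : 0 < σ := hpos _
  have hsig : ∀ s, σ ≤ sig s := fun s => hmono _ _ (by rw [Fin.le_def]; simp; omega)
  set Z := Zstar * V with hZ
  have hG : Zᵀ * Z = Matrix.diagonal sig := by
    calc Zᵀ * Z = Vᵀ * (Zstarᵀ * Zstar) * V := by
          rw [hZ, Matrix.transpose_mul]; simp only [Matrix.mul_assoc]
      _ = (Vᵀ * V) * Matrix.diagonal sig * (Vᵀ * V) := by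
          rw [hGV]; simp only [Matrix.mul_assoc]
      _ = _ := by rw [hV.2, Matrix.mul_one, Matrix.one_mul]
  have hXX : Zstar * Zstarᵀ = Z * Zᵀ := by
    rw [hZ, Matrix.transpose_mul]
    calc _ = Zstar * (V * Vᵀ) * Zstarᵀ := by rw [hV.1, Matrix.mul_one]
      _ = _ := by simp only [Matrix.mul_assoc]
  rw [hXX] at hb
  have hop := opNorm_D hr A Z sig hmono hG b hb δ hA1
  have hM : ((1 / (m : ℝ)) • ∑ k, (b k) • A k)ᵀ = (1 / (m : ℝ)) • ∑ k, (b k) • A k := by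
    rw [Matrix.transpose_smul, Matrix.transpose_sum]
    simp only [Matrix.transpose_smul, (hAsym _).eq]
  set M := (1 / (m : ℝ)) • ∑ k, (b k) • A k with hMdef
  have hD := opNorm_mulVec _ _ hop
  have hr1 : (1 : ℝ) ≤ r := by exact_mod_cast hr
  have hsq1 : 1 ≤ Real.sqrt r := Real.one_le_sqrt.mpr hr1
  have hδ' : δ * (4 * Real.sqrt r) ≤ σ := (le_div_iff₀ (by positivity)).mp hδ
  have hδσ : δ < σ := by nlinarith
  have hδ2 : 2 * r * δ ^ 2 ≤ σ ^ 2 / 8 := by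
    have h1 := pow_le_pow_left₀ (by positivity) hδ' 2
    have h2 := Real.sq_sqrt (show (0 : ℝ) ≤ r by positivity)
    have h3 : (δ * (4 * Real.sqrt r)) ^ 2 = 16 * δ ^ 2 * Real.sqrt r ^ 2 := by ring
    rw [h3, h2] at h1
    linarith
  have htail := tail_bound M Z δ hδ0.le hD hM lam v horth heig hsort
  have hhead := head_bound M Z sig σ hσ hsig hG δ hδ0.le hδσ hD hM lam v horth heig hsort
  have hE := E_bound hrn M Z Z0 δ hD hM lam v horth heig htail hhead hZ0
  obtain ⟨R, hR, hfin⟩ := finish hr Z Z0 sig σ hσ hsig hG δ hδ0.le hδσ hδ2 hE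
  have hmem : Z * R ∈ solSet Zstar := by
    refine ⟨V * R, ⟨?_, ?_⟩, Matrix.mul_assoc _ _ _⟩
    · rw [Matrix.transpose_mul]
      calc _ = V * (R * Rᵀ) * Vᵀ := by simp only [Matrix.mul_assoc]
        _ = 1 := by rw [hR.1, Matrix.mul_one, hV.1]
    · rw [Matrix.transpose_mul]
      calc _ = Rᵀ * (Vᵀ * V) * R := by simp only [Matrix.mul_assoc]
        _ = 1 := by rw [hV.2, Matrix.mul_one, hR.2]
  have hbdd : BddBelow (Set.range fun Zt : solSet Zstar =>
      frobNorm (Z0 - (Zt : Matrix (Fin n) (Fin r) ℝ))) :=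
    ⟨0, by rintro _ ⟨x, rfl⟩; exact Real.sqrt_nonneg _⟩
  refine (ciInf_le hbdd ⟨Z * R, hmem⟩).trans ?_
  unfold frobNorm
  apply Real.sqrt_le_sqrt
  rw [frobNorm_sq_eq]
  exact hfin
end
end

section
/- (Local curvature condition.) Suppose Assumptions A1 and A2 both hold with parameter δ satisfying 0 < δ ≤ σ_r/16. Then for any Z ∈ R^{n×r} with d(Z, Z*) ≤ √((3/16) σ_r), setting H = Z − Z̄, we have ⟨∇f(Z), H⟩ ≥ (27/64) σ_r ‖H‖_F² + ‖H^T Z̄‖_F². -/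
open Matrix MeasureTheory ProbabilityTheory Real
open scoped BigOperators ENNReal

noncomputable section

namespace LCC

/-- Euclidean norm of a plain vector. -/
def nrm {n : ℕ} (x : Fin n → ℝ) : ℝ := ‖(WithLp.toLp 2 x : EuclideanSpace ℝ (Fin n))‖

lemma nrm_sq {n : ℕ} (x : Fin n → ℝ) : nrm x ^ 2 = ∑ i, x i ^ 2 := by
  unfold nrm
  rw [EuclideanSpace.norm_sq_eq]
  simp

lemma nrm_nonneg {n : ℕ} (x : Fin n → ℝ) : 0 ≤ nrm x := norm_nonneg _

lemma abs_dot_le {n : ℕ} (x y : Fin n → ℝ) : |x ⬝ᵥ y| ≤ nrm x * nrm y := by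
  have h := abs_real_inner_le_norm (WithLp.toLp 2 y : EuclideanSpace ℝ (Fin n)) (WithLp.toLp 2 x)
  rw [mul_comm] at h
  have e : inner ℝ (WithLp.toLp 2 y : EuclideanSpace ℝ (Fin n)) (WithLp.toLp 2 x) = x ⬝ᵥ y := by
    rw [EuclideanSpace.inner_eq_star_dotProduct]
    simp
  rw [e] at h
  exact h

lemma abs_quad_le {n : ℕ} (M : Matrix (Fin n) (Fin n) ℝ) (x y : Fin n → ℝ) (d : ℝ)
    (hM : opNorm M ≤ d) : |x ⬝ᵥ M *ᵥ y| ≤ d * (nrm x * nrm y) := by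
  have h1 : nrm (M *ᵥ y) ≤ opNorm M * nrm y := by
    have := (LinearMap.toContinuousLinearMap (Matrix.toEuclideanLin M)).le_opNorm
      (WithLp.toLp 2 y : EuclideanSpace ℝ (Fin n))
    simpa [nrm, opNorm, Matrix.toLpLin_toLp] using this
  have h2 := abs_dot_le x (M *ᵥ y)
  have hx := nrm_nonneg x
  have hy := nrm_nonneg y
  calc |x ⬝ᵥ M *ᵥ y| ≤ nrm x * nrm (M *ᵥ y) := h2
    _ ≤ nrm x * (d * nrm y) := by
        gcongr
        exact h1.trans (by gcongr)
    _ = _ := by ring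

lemma frob_sq {a b : ℕ} (M : Matrix (Fin a) (Fin b) ℝ) :
    frobNorm M ^ 2 = ∑ i, ∑ j, (M i j) ^ 2 := by
  unfold frobNorm
  rw [Real.sq_sqrt]
  positivity

lemma frob_sq_cols {a b : ℕ} (M : Matrix (Fin a) (Fin b) ℝ) :
    frobNorm M ^ 2 = ∑ s, nrm (fun j => M j s) ^ 2 := by
  rw [frob_sq, Finset.sum_comm]
  simp [nrm_sq]

lemma frob_sq_trace {a b : ℕ} (M : Matrix (Fin a) (Fin b) ℝ) :
    frobNorm M ^ 2 = trace (Mᵀ * M) := by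
  rw [frob_sq, Finset.sum_comm]
  simp [trace, Matrix.mul_apply, sq]

lemma frobInner_trace {a b : ℕ} (M N : Matrix (Fin a) (Fin b) ℝ) :
    frobInner M N = trace (Nᵀ * M) := by
  unfold frobInner
  rw [Finset.sum_comm]
  simp [trace, Matrix.mul_apply, mul_comm]

lemma trace_cols {n r : ℕ} (X Y : Matrix (Fin n) (Fin r) ℝ) (A : Matrix (Fin n) (Fin n) ℝ) :
    trace (Xᵀ * A * Y) = ∑ s, (fun j => X j s) ⬝ᵥ A *ᵥ (fun j => Y j s) := by
  rw [Matrix.mul_assoc]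
  simp [trace, Matrix.mul_apply, dotProduct, mulVec]

/-- Givens rotations give symmetry of the alignment. -/
lemma givens {r : ℕ} (p q : Fin r) (hpq : p ≠ q) (c s : ℝ) (hcs : c ^ 2 + s ^ 2 = 1) :
    IsOrthoMat ((1 : Matrix (Fin r) (Fin r) ℝ) + (c - 1) • (single p p 1 + single q q 1)
      + s • (single p q 1 - single q p 1)) := by
  obtain ⟨P, hP⟩ : ∃ P : Matrix (Fin r) (Fin r) ℝ, P = single p p 1 + single q q 1 := ⟨_, rfl⟩
  obtain ⟨J, hJ⟩ : ∃ J : Matrix (Fin r) (Fin r) ℝ, J = single p q 1 - single q p 1 := ⟨_, rfl⟩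
  have hPP : P * P = P := by
    rw [hP]; simp [Matrix.add_mul, Matrix.mul_add, hpq, hpq.symm]
  have hJJ : J * J = -P := by
    rw [hJ, hP]; simp [Matrix.sub_mul, Matrix.mul_sub, hpq, hpq.symm]; abel
  have hPJ : P * J = J := by
    rw [hJ, hP]; simp [Matrix.add_mul, Matrix.mul_sub, hpq, hpq.symm]; try abel
  have hJP : J * P = J := by
    rw [hJ, hP]; simp [Matrix.sub_mul, Matrix.mul_add, hpq, hpq.symm]; try abel
  have hPt : Pᵀ = P := by rw [hP]; simp
  have hJt : Jᵀ = -J := by rw [hJ]; simp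
  rw [← hP, ← hJ]
  have hz : (2 * (c - 1) + (c - 1) ^ 2 + s ^ 2) = 0 := by linarith
  have key : (1 + (2 * (c - 1) + (c - 1) ^ 2 + s ^ 2) • P) = 1 := by rw [hz]; simp
  constructor
  · refine Eq.trans ?_ key
    simp only [transpose_add, transpose_smul, hPt, hJt, transpose_one, Matrix.add_mul,
      Matrix.mul_add, Matrix.smul_mul, Matrix.mul_smul, hPP, hPJ, hJP, hJJ, Matrix.mul_neg,
      Matrix.mul_one, Matrix.one_mul]
    module
  · refine Eq.trans ?_ key
    simp only [transpose_add, transpose_smul, hPt, hJt, transpose_one, Matrix.add_mul,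
      Matrix.mul_add, Matrix.smul_mul, Matrix.mul_smul, hPP, hPJ, hJP, hJJ, Matrix.neg_mul,
      Matrix.mul_one, Matrix.one_mul]
    module

lemma sym_of_max {r : ℕ} (M : Matrix (Fin r) (Fin r) ℝ)
    (h : ∀ W, IsOrthoMat W → trace (M * W) ≤ trace M) : Mᵀ = M := by
  ext p q
  rw [transpose_apply]
  by_cases hpq : p = q
  · rw [hpq]
  have key : ∀ t : ℝ, t * (M q p - M p q) ≤ t ^ 2 * (M p p + M q q) := by
    intro t
    have ht : (0 : ℝ) < 1 + t ^ 2 := by positivity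
    have h1 := h _ (givens p q hpq ((1 - t ^ 2) / (1 + t ^ 2)) (2 * t / (1 + t ^ 2))
      (by field_simp; ring))
    simp only [Matrix.mul_add, Matrix.mul_sub, Matrix.mul_smul, trace_add, trace_sub, trace_smul,
      Matrix.mul_one, trace_mul_single, smul_eq_mul, mul_one] at h1
    have e : (1 - t ^ 2) / (1 + t ^ 2) - 1 = -(2 * t ^ 2) / (1 + t ^ 2) := by
      field_simp; ring
    rw [e] at h1
    have h2 : (2 * t * (M q p - M p q) - 2 * t ^ 2 * (M p p + M q q)) / (1 + t ^ 2) ≤ 0 := by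
      have : (2 * t * (M q p - M p q) - 2 * t ^ 2 * (M p p + M q q)) / (1 + t ^ 2)
        = -(2 * t ^ 2) / (1 + t ^ 2) * (M p p + M q q)
          + 2 * t / (1 + t ^ 2) * (M q p - M p q) := by ring
      rw [this]; simp only [MulOpposite.smul_eq_mul_unop, MulOpposite.unop_op, mul_one] at h1; linarith
    have h3 : (2 * t * (M q p - M p q) - 2 * t ^ 2 * (M p p + M q q)) ≤ 0 := by
      rw [div_le_iff₀ ht] at h2; linarith
    linarith
  obtain ⟨β, hβ⟩ : ∃ β, β = M q p - M p q := ⟨_, rfl⟩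
  obtain ⟨α, hα⟩ : ∃ α, α = M p p + M q q := ⟨_, rfl⟩
  rw [← hβ, ← hα] at key
  have hK : 0 < |α| + 1 := by positivity
  have k1 := key (β / (|α| + 1))
  have : β ^ 2 * (|α| + 1) ≤ β ^ 2 * α := by
    have := mul_le_mul_of_nonneg_right k1 (sq_nonneg (|α| + 1))
    have e1 : β / (|α| + 1) * β * (|α| + 1) ^ 2 = β ^ 2 * (|α| + 1) := by field_simp
    have e2 : (β / (|α| + 1)) ^ 2 * α * (|α| + 1) ^ 2 = β ^ 2 * α := by field_simp
    rw [e1, e2] at this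
    exact this
  have hb : β ^ 2 ≤ 0 := by nlinarith [le_abs_self α, sq_nonneg β]
  have : β = 0 := by nlinarith [sq_nonneg β]
  linarith

lemma frob_sq_sub {a b : ℕ} (X Y : Matrix (Fin a) (Fin b) ℝ) :
    frobNorm (X - Y) ^ 2 = trace (Xᵀ * X) - 2 * trace (Xᵀ * Y) + trace (Yᵀ * Y) := by
  rw [frob_sq_trace]
  have : trace (Yᵀ * X) = trace (Xᵀ * Y) := by
    rw [← trace_transpose, transpose_mul, transpose_transpose]
  simp only [transpose_sub, Matrix.sub_mul, Matrix.mul_sub, trace_sub, this]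
  ring

lemma ortho_mul {r : ℕ} {U W : Matrix (Fin r) (Fin r) ℝ} (hU : IsOrthoMat U)
    (hW : IsOrthoMat W) : IsOrthoMat (U * W) := by
  constructor
  · rw [transpose_mul, Matrix.mul_assoc, ← Matrix.mul_assoc W, hW.1, Matrix.one_mul, hU.1]
  · rw [transpose_mul, Matrix.mul_assoc, ← Matrix.mul_assoc Uᵀ, hU.2, Matrix.one_mul, hW.2]

lemma ortho_transpose {r : ℕ} {U : Matrix (Fin r) (Fin r) ℝ} (hU : IsOrthoMat U) :
    IsOrthoMat Uᵀ := ⟨by rw [transpose_transpose]; exact hU.2, by rw [transpose_transpose]; exact hU.1⟩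

lemma mem_solSet {n r : ℕ} (Zstar Zt : Matrix (Fin n) (Fin r) ℝ) :
    Zt ∈ solSet Zstar ↔ ∃ U : Matrix (Fin r) (Fin r) ℝ, IsOrthoMat U ∧ Zt = Zstar * U := Iff.rfl

lemma closest_symm {n r : ℕ} (Zstar Z Zbar : Matrix (Fin n) (Fin r) ℝ)
    (h : IsClosest Zstar Z Zbar) : (Zᵀ * Zbar)ᵀ = Zᵀ * Zbar := by
  apply sym_of_max
  intro W hW
  obtain ⟨hm, hmin⟩ := h
  obtain ⟨U, hU, hZU⟩ := (mem_solSet _ _).1 hm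
  have h1 := hmin (Zbar * W)
    ((mem_solSet _ _).2 ⟨U * W, ortho_mul hU hW, by rw [hZU, Matrix.mul_assoc]⟩)
  have h2 : frobNorm (Z - Zbar) ^ 2 ≤ frobNorm (Z - Zbar * W) ^ 2 := by
    have : 0 ≤ frobNorm (Z - Zbar) := Real.sqrt_nonneg _
    gcongr
  rw [frob_sq_sub, frob_sq_sub] at h2
  have e : trace ((Zbar * W)ᵀ * (Zbar * W)) = trace (Zbarᵀ * Zbar) := by
    rw [transpose_mul, trace_mul_comm, Matrix.mul_assoc, ← Matrix.mul_assoc W, hW.1,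
      Matrix.one_mul, trace_mul_comm]
  rw [e, ← Matrix.mul_assoc] at h2
  linarith

/-- Weighted lower bound on the Gram form. -/
lemma gram_lower {n r : ℕ} (Y H : Matrix (Fin n) (Fin r) ℝ) (Q : Matrix (Fin r) (Fin r) ℝ)
    (hQ : IsOrthoMat Q) (sig : Fin r → ℝ) (hY : Yᵀ * Y = Q * diagonal sig * Qᵀ) (σ : ℝ)
    (hσ : ∀ s, σ ≤ sig s) :
    σ * frobNorm H ^ 2 ≤ trace (Yᵀ * Y * (Hᵀ * H)) := by
  have e1 : trace (Yᵀ * Y * (Hᵀ * H)) = ∑ s, sig s * ∑ j, ((H * Q) j s) ^ 2 := by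
    rw [hY]
    have : trace (Q * diagonal sig * Qᵀ * (Hᵀ * H))
        = trace (diagonal sig * ((H * Q)ᵀ * (H * Q))) := by
      rw [Matrix.mul_assoc, Matrix.mul_assoc, trace_mul_comm, transpose_mul]
      simp only [Matrix.mul_assoc]
    rw [this]
    simp only [trace, diag_apply, diagonal_mul]
    simp only [Matrix.mul_apply (M := (H * Q)ᵀ), transpose_apply, sq]
  have e2 : frobNorm H ^ 2 = ∑ s, ∑ j, ((H * Q) j s) ^ 2 := by
    rw [Finset.sum_comm, ← frob_sq, frob_sq_trace, frob_sq_trace, transpose_mul,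
      trace_mul_comm (Qᵀ * Hᵀ), Matrix.mul_assoc H, ← Matrix.mul_assoc Q, hQ.1, Matrix.one_mul, trace_mul_comm H]
  rw [e1, e2, Finset.mul_sum]
  gcongr with s
  exact hσ s

lemma quad_rank {n : ℕ} (A : Matrix (Fin n) (Fin n) ℝ) (hA : A.IsSymm) (x y z w : Fin n → ℝ) :
    x ⬝ᵥ (A * vecMulVec z w * A) *ᵥ y = (x ⬝ᵥ A *ᵥ z) * (y ⬝ᵥ A *ᵥ w) := by
  rw [← mulVec_mulVec, ← mulVec_mulVec, vecMulVec_mulVec, mulVec_smul, dotProduct_smul]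
  have : w ⬝ᵥ A *ᵥ y = y ⬝ᵥ A *ᵥ w := by
    rw [dotProduct_mulVec, ← mulVec_transpose, hA.eq, dotProduct_comm]
  rw [this]
  simp [mul_comm]

end LCC

open LCC

theorem local_curvature_condition {n r m : ℕ} (hr : 0 < r)
    (A : Fin m → Matrix (Fin n) (Fin n) ℝ) (hAsym : ∀ i, (A i).IsSymm)
(Zstar : Matrix (Fin n) (Fin r) ℝ)
    (sig : Fin r → ℝ) (hpos : ∀ s, 0 < sig s)
    (hmono : ∀ s t : Fin r, s ≤ t → sig t ≤ sig s)
    (hspec : ∃ V, IsOrthoMat V ∧ Zstarᵀ * Zstar = V * Matrix.diagonal sig * Vᵀ)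
    (b : Fin m → ℝ) (hb : ∀ i, b i = Matrix.trace (A i * (Zstar * Zstarᵀ)))
    (δ : ℝ) (hδ0 : 0 < δ) (hδ : δ ≤ (sig ⟨r - 1, Nat.sub_lt hr Nat.one_pos⟩) / 16)
    (hA1 : AssumpA1 A (sig ⟨0, hr⟩) r δ)
    (hA2 : AssumpA2 A Zstar δ)
    (Z Zbar : Matrix (Fin n) (Fin r) ℝ)
    (hZ : dSol Z Zstar ≤ Real.sqrt (3 / 16 * (sig ⟨r - 1, Nat.sub_lt hr Nat.one_pos⟩)))
    (hZbar : IsClosest Zstar Z Zbar) :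
    frobInner (gradf A b Z) (Z - Zbar) ≥
      27 / 64 * (sig ⟨r - 1, Nat.sub_lt hr Nat.one_pos⟩) * frobNorm (Z - Zbar) ^ 2
        + frobNorm ((Z - Zbar)ᵀ * Zbar) ^ 2 := by

  obtain ⟨V, hV, hVs⟩ := hspec
  obtain ⟨σ, hσ⟩ : ∃ σ, σ = sig ⟨r - 1, Nat.sub_lt hr Nat.one_pos⟩ := ⟨_, rfl⟩
  rw [← hσ] at hδ hZ ⊢
  have hσpos : 0 < σ := hσ ▸ hpos _
  have hσle : ∀ s, σ ≤ sig s := by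
    intro s
    rw [hσ]
    apply hmono
    rw [Fin.le_def]
    have := s.2
    simp only
    omega
  obtain ⟨H, hH⟩ : ∃ H, H = Z - Zbar := ⟨_, rfl⟩
  have hZH : Z = Zbar + H := by rw [hH]; abel
  -- the distance bound
  have hHn : frobNorm H ^ 2 ≤ 3 / 16 * σ := by
    have h1 : frobNorm H ≤ dSol Z Zstar := by
      unfold dSol
      have : Nonempty (solSet Zstar) := ⟨⟨Zbar, hZbar.1⟩⟩
      apply le_ciInf
      intro Zt
      rw [hH]
      exact hZbar.2 _ Zt.2
    have h0 : 0 ≤ frobNorm H := Real.sqrt_nonneg _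
    have h2 := h1.trans hZ
    calc frobNorm H ^ 2 ≤ (Real.sqrt (3 / 16 * σ)) ^ 2 := by gcongr
      _ = 3 / 16 * σ := Real.sq_sqrt (by positivity)
  -- symmetry
  have hsym : (Hᵀ * Zbar)ᵀ = Hᵀ * Zbar := by
    have h1 := closest_symm Zstar Z Zbar hZbar
    rw [hH, transpose_sub, Matrix.sub_mul, transpose_sub, h1, transpose_mul, transpose_transpose]
  rw [← hH]
  have hmem := hZbar.1
  obtain ⟨U, hU, hZU⟩ := (mem_solSet _ _).1 hZbar.1
  have hgram : Zbarᵀ * Zbar = (Uᵀ * V) * diagonal sig * (Uᵀ * V)ᵀ := by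
    rw [hZU, transpose_mul, transpose_mul, transpose_transpose, Matrix.mul_assoc,
      ← Matrix.mul_assoc Zstarᵀ, hVs]
    simp only [Matrix.mul_assoc]
  have hlow := gram_lower Zbar H (Uᵀ * V) (ortho_mul (ortho_transpose hU) hV) sig hgram σ hσle
  have hZZ : Zstar * Zstarᵀ = Zbar * Zbarᵀ := by
    rw [hZU, transpose_mul, Matrix.mul_assoc, ← Matrix.mul_assoc U, hU.1, Matrix.one_mul]
  obtain ⟨c, hc⟩ : ∃ c : ℝ, c = 1 / (m : ℝ) := ⟨_, rfl⟩
  have hc0 : 0 ≤ c := by rw [hc]; positivity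
  -- columns
  obtain ⟨h, hh⟩ : ∃ h : Fin r → Fin n → ℝ, h = fun s j => H j s := ⟨_, rfl⟩
  obtain ⟨z, hz⟩ : ∃ z : Fin r → Fin n → ℝ, z = fun s j => Zbar j s := ⟨_, rfl⟩
  obtain ⟨a, ha⟩ : ∃ a : Fin m → ℝ, a = fun i => ∑ s, h s ⬝ᵥ A i *ᵥ z s := ⟨_, rfl⟩
  obtain ⟨q, hq⟩ : ∃ q : Fin m → ℝ, q = fun i => ∑ s, h s ⬝ᵥ A i *ᵥ h s := ⟨_, rfl⟩
  have hta : ∀ i, trace (Hᵀ * A i * Zbar) = a i := by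
    intro i; rw [trace_cols, ha, hh, hz]
  have htq : ∀ i, trace (Hᵀ * A i * H) = q i := by
    intro i; rw [trace_cols, hq, hh]
  have hgrad : frobInner (gradf A b Z) H = c * ∑ i, (2 * a i + q i) * (a i + q i) := by
    rw [frobInner_trace, gradf, ← hc, Matrix.mul_smul, trace_smul, smul_eq_mul, Matrix.mul_sum,
      trace_sum]
    congr 1
    apply Finset.sum_congr rfl
    intro i _
    have t1 : trace (Zbarᵀ * A i * H) = a i := by
      rw [← hta, ← trace_transpose, transpose_mul, transpose_mul, transpose_transpose,
        (hAsym i).eq, Matrix.mul_assoc]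
    have t2 : b i = trace (Zbarᵀ * A i * Zbar) := by
      rw [hb, hZZ, ← Matrix.mul_assoc, trace_mul_comm, Matrix.mul_assoc]
    rw [Matrix.mul_smul, trace_smul, smul_eq_mul, t2, hZH]
    simp only [transpose_add, Matrix.add_mul, Matrix.mul_add, trace_add, ← Matrix.mul_assoc, hta,
      htq, t1]
    ring
  have hbound : c * ∑ i, (2 * a i + q i) * (a i + q i)
      ≥ c * ∑ i, a i ^ 2 - 5 / 4 * (c * ∑ i, q i ^ 2) := by
    have : c * ∑ i, a i ^ 2 - 5 / 4 * (c * ∑ i, q i ^ 2)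
        = c * ∑ i, (a i ^ 2 - 5 / 4 * q i ^ 2) := by
      rw [Finset.sum_sub_distrib, ← Finset.mul_sum]; ring
    rw [this, ge_iff_le]
    gcongr with i
    nlinarith [sq_nonneg (a i + 3 / 2 * q i)]
  have hFc : frobNorm H ^ 2 = ∑ s, nrm (h s) ^ 2 := by
    rw [frob_sq_cols, hh]
  have hrpos : (0 : ℝ) < r := by exact_mod_cast hr
  -- first-order term
  have hA : c * ∑ i, a i ^ 2 ≥ σ * frobNorm H ^ 2 + frobNorm (Hᵀ * Zbar) ^ 2
      - δ / 2 * frobNorm H ^ 2 := by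
    have e1 : c * ∑ i, a i ^ 2 = ∑ s, ∑ k, c * ∑ i, (h s ⬝ᵥ A i *ᵥ z s) * (h k ⬝ᵥ A i *ᵥ z k) := by
      simp only [ha, sq, Finset.sum_mul_sum]
      simp only [Finset.mul_sum]
      rw [Finset.sum_comm]
      apply Finset.sum_congr rfl
      intro s _
      rw [Finset.sum_comm]
    have e2 : ∀ s k, c * ∑ i, (h s ⬝ᵥ A i *ᵥ z s) * (h k ⬝ᵥ A i *ᵥ z k) ≥
        (z s ⬝ᵥ z k) * (h s ⬝ᵥ h k) + (h s ⬝ᵥ z k) * (h k ⬝ᵥ z s)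
          - δ / r / 2 * (nrm (h s) * nrm (h k)) := by
      intro s k
      have h1 := abs_quad_le _ (h s) (h k) _ (hA2 Zbar hmem s k)
      have hzs : ∀ s, (fun j => Zbar j s) = z s := by intro s; rw [hz]
      rw [hzs, hzs, ← hc] at h1
      rw [sub_mulVec, dotProduct_sub, smul_mulVec, dotProduct_smul, sum_mulVec,
        dotProduct_sum, add_mulVec, dotProduct_add, smul_mulVec, dotProduct_smul, one_mulVec,
        smul_mulVec, dotProduct_smul, vecMulVec_mulVec, dotProduct_smul] at h1
      have e3 : ∀ i, h s ⬝ᵥ ((2 : ℝ) • (A i * vecMulVec (z s) (z k) * A i)) *ᵥ h k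
          = 2 * ((h s ⬝ᵥ A i *ᵥ z s) * (h k ⬝ᵥ A i *ᵥ z k)) := by
        intro i
        rw [smul_mulVec, dotProduct_smul, quad_rank _ (hAsym i), smul_eq_mul]
      simp only [e3, ← Finset.mul_sum, smul_eq_mul, MulOpposite.smul_eq_mul_unop,
        MulOpposite.unop_op] at h1
      have h2 := (abs_le.1 h1).1
      rw [dotProduct_comm (z s) (h k)] at h2
      linarith
    have e4 : ∑ s, ∑ k, ((z s ⬝ᵥ z k) * (h s ⬝ᵥ h k) + (h s ⬝ᵥ z k) * (h k ⬝ᵥ z s)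
          - δ / r / 2 * (nrm (h s) * nrm (h k)))
        = trace (Zbarᵀ * Zbar * (Hᵀ * H)) + frobNorm (Hᵀ * Zbar) ^ 2
          - δ / r / 2 * (∑ s, nrm (h s)) ^ 2 := by
      simp only [Finset.sum_sub_distrib, Finset.sum_add_distrib]
      congr 1
      · congr 1
        · simp only [trace, diag_apply, Matrix.mul_apply (M := Zbarᵀ * Zbar)]
          apply Finset.sum_congr rfl
          intro s _
          apply Finset.sum_congr rfl
          intro k _
          rw [dotProduct_comm (h s) (h k), hz, hh]
          simp [Matrix.mul_apply, dotProduct]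
        · rw [frob_sq]
          apply Finset.sum_congr rfl
          intro s _
          apply Finset.sum_congr rfl
          intro k _
          have hsk : (Hᵀ * Zbar) k s = (Hᵀ * Zbar) s k := by
            conv_rhs => rw [← hsym]
            rfl
          have g : ∀ s k, (Hᵀ * Zbar) s k = h s ⬝ᵥ z k := by
            intro s k; rw [hh, hz]; simp [Matrix.mul_apply, dotProduct]
          rw [← g, ← g, hsk, sq]
      · rw [sq, Finset.sum_mul_sum, Finset.mul_sum]
        simp only [Finset.mul_sum]
    have e5 : (∑ s, nrm (h s)) ^ 2 ≤ r * frobNorm H ^ 2 := by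
      rw [hFc]
      have := sq_sum_le_card_mul_sum_sq (s := (Finset.univ : Finset (Fin r)))
        (f := fun s => nrm (h s))
      simpa using this
    have e6 : δ / r / 2 * (∑ s, nrm (h s)) ^ 2 ≤ δ / 2 * frobNorm H ^ 2 := by
      calc δ / r / 2 * (∑ s, nrm (h s)) ^ 2 ≤ δ / r / 2 * (r * frobNorm H ^ 2) := by gcongr
        _ = _ := by field_simp
    have e7 : c * ∑ i, a i ^ 2 ≥ trace (Zbarᵀ * Zbar * (Hᵀ * H)) + frobNorm (Hᵀ * Zbar) ^ 2
          - δ / r / 2 * (∑ s, nrm (h s)) ^ 2 := by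
      rw [e1, ← e4, ge_iff_le]
      gcongr with s _ k _
      exact e2 s k
    linarith
  -- second-order term
  have hQ : c * ∑ i, q i ^ 2 ≤ 2 * (frobNorm H ^ 2) ^ 2 + δ * frobNorm H ^ 2 := by
    have e1 : c * ∑ i, q i ^ 2 = ∑ s, ∑ k, c * ∑ i, (h s ⬝ᵥ A i *ᵥ h s) * (h k ⬝ᵥ A i *ᵥ h k) := by
      simp only [hq, sq, Finset.sum_mul_sum]
      simp only [Finset.mul_sum]
      rw [Finset.sum_comm]
      apply Finset.sum_congr rfl
      intro s _
      rw [Finset.sum_comm]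
    have e2 : ∀ s k, c * ∑ i, (h s ⬝ᵥ A i *ᵥ h s) * (h k ⬝ᵥ A i *ᵥ h k) ≤
        2 * (nrm (h s) ^ 2 * nrm (h k) ^ 2) + δ / r * nrm (h k) ^ 2 := by
      intro s k
      have hs : Real.sqrt (∑ i, h s i ^ 2) ≤ Real.sqrt (sig ⟨0, hr⟩) := by
        apply Real.sqrt_le_sqrt
        rw [← nrm_sq]
        have : nrm (h s) ^ 2 ≤ frobNorm H ^ 2 := by
          rw [hFc]
          exact Finset.single_le_sum (f := fun s => nrm (h s) ^ 2)
            (fun i _ => sq_nonneg _) (Finset.mem_univ s)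
        have := hσle ⟨0, hr⟩
        linarith
      have h1 := abs_quad_le _ (h k) (h k) _ (hA1 (h s) hs)
      rw [← hc] at h1
      rw [sub_mulVec, dotProduct_sub, smul_mulVec, dotProduct_smul, sum_mulVec,
        dotProduct_sum, smul_mulVec, dotProduct_smul, vecMulVec_mulVec, dotProduct_smul] at h1
      simp only [smul_mulVec, dotProduct_smul, smul_eq_mul, MulOpposite.smul_eq_mul_unop,
        MulOpposite.unop_op] at h1
      have h2 := (abs_le.1 h1).2
      have h3 := abs_dot_le (h s) (h k)
      have h4 : (h s ⬝ᵥ h k) ^ 2 ≤ (nrm (h s) * nrm (h k)) ^ 2 := by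
        rw [← sq_abs]
        gcongr
      rw [dotProduct_comm (h k) (h s)] at h2
      nlinarith
    have e3 : ∑ s : Fin r, ∑ k, (2 * (nrm (h s) ^ 2 * nrm (h k) ^ 2) + δ / r * nrm (h k) ^ 2)
        = 2 * (frobNorm H ^ 2) ^ 2 + δ * frobNorm H ^ 2 := by
      simp only [Finset.sum_add_distrib, ← Finset.mul_sum, ← Finset.sum_mul, ← hFc]
      simp only [Finset.sum_const, Finset.card_univ, Fintype.card_fin, nsmul_eq_mul]
      field_simp
    rw [e1, ← e3]
    gcongr with s _ k _
    exact e2 s k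
  rw [hgrad]
  have hF0 : 0 ≤ frobNorm H ^ 2 := sq_nonneg _
  have p1 : δ * frobNorm H ^ 2 ≤ σ / 16 * frobNorm H ^ 2 := by gcongr
  have p2 : (frobNorm H ^ 2) ^ 2 ≤ 3 / 16 * σ * frobNorm H ^ 2 := by
    rw [sq (frobNorm H ^ 2)]; gcongr
  linarith
end
end

section
/- (Regularity condition.) Suppose Assumptions A1 and A2 both hold with parameter δ satisfying 0 < δ ≤ σ_r/16, and suppose in addition that (1/m) Σ_{i=1}^m ‖A_i‖² ≤ 9n (operator norms). Then f satisfies the regularity condition RC(√((3/16) σ_r), 24, 513 κ n) where κ = σ_1/σ_r; that is, for every Z ∈ R^{n×r} with d(Z, Z*) ≤ √((3/16) σ_r), setting H = Z − Z̄, we have ⟨∇f(Z), H⟩ ≥ (1/24) σ_r ‖H‖_F² + (σ_r/σ_1) · ‖∇f(Z)‖_F² / (513 n ‖Z*‖_F²). -/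
open Matrix MeasureTheory ProbabilityTheory Real
open scoped BigOperators ENNReal

noncomputable section

/-- Column of a matrix. -/
def colv {a b : ℕ} (M : Matrix (Fin a) (Fin b) ℝ) (s : Fin b) : Fin a → ℝ := fun j => M j s

/-- squared norm -/
def sqn {a : ℕ} (u : Fin a → ℝ) : ℝ := ∑ i, u i ^ 2

lemma sqn_nonneg {a : ℕ} (u : Fin a → ℝ) : 0 ≤ sqn u := Finset.sum_nonneg fun _ _ => sq_nonneg _

lemma norm_toLp_sqn {a : ℕ} (u : Fin a → ℝ) : ‖WithLp.toLp 2 u‖ = Real.sqrt (sqn u) := by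
  rw [EuclideanSpace.norm_eq]; simp [sqn]

lemma opNorm_nonneg {n : ℕ} (M : Matrix (Fin n) (Fin n) ℝ) : 0 ≤ opNorm M := norm_nonneg _

lemma norm_mulVec_le {n : ℕ} (M : Matrix (Fin n) (Fin n) ℝ) (y : Fin n → ℝ) :
    Real.sqrt (sqn (M *ᵥ y)) ≤ opNorm M * Real.sqrt (sqn y) := by
  rw [← norm_toLp_sqn, ← norm_toLp_sqn]
  have := (LinearMap.toContinuousLinearMap (Matrix.toEuclideanLin M)).le_opNorm (WithLp.toLp 2 y)
  simpa [opNorm, Matrix.toEuclideanLin] using this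

lemma sqn_mulVec_le {n : ℕ} (M : Matrix (Fin n) (Fin n) ℝ) (y : Fin n → ℝ) :
    sqn (M *ᵥ y) ≤ opNorm M ^ 2 * sqn y := by
  have h := norm_mulVec_le M y
  have h2 := pow_le_pow_left₀ (Real.sqrt_nonneg _) h 2
  rwa [mul_pow, Real.sq_sqrt (sqn_nonneg _), Real.sq_sqrt (sqn_nonneg _)] at h2

lemma dot_sq_le {n : ℕ} (x y : Fin n → ℝ) : (x ⬝ᵥ y) ^ 2 ≤ sqn x * sqn y :=
  Finset.sum_mul_sq_le_sq_mul_sq _ _ _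

lemma abs_bilin_le {n : ℕ} (M : Matrix (Fin n) (Fin n) ℝ) (x y : Fin n → ℝ) :
    |x ⬝ᵥ M *ᵥ y| ≤ opNorm M * (Real.sqrt (sqn x) * Real.sqrt (sqn y)) := by
  apply abs_le_of_sq_le_sq _ (mul_nonneg (opNorm_nonneg _) (by positivity))
  rw [mul_pow, mul_pow, Real.sq_sqrt (sqn_nonneg _), Real.sq_sqrt (sqn_nonneg _)]
  have h1 := dot_sq_le x (M *ᵥ y)
  have h2 := mul_le_mul_of_nonneg_left (sqn_mulVec_le M y) (sqn_nonneg x)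
  linarith

/-- squared Frobenius norm by columns -/
lemma frob_sq {a b : ℕ} (M : Matrix (Fin a) (Fin b) ℝ) :
    frobNorm M ^ 2 = ∑ s, sqn (colv M s) := by
  have h0 : 0 ≤ ∑ i, ∑ j, M i j ^ 2 :=
    Finset.sum_nonneg fun _ _ => Finset.sum_nonneg fun _ _ => sq_nonneg _
  rw [frobNorm, Real.sq_sqrt h0, Finset.sum_comm]
  rfl

lemma frob_mul_ortho {a b : ℕ} (M : Matrix (Fin a) (Fin b) ℝ) (W : Matrix (Fin b) (Fin b) ℝ)
    (hW : IsOrthoMat W) : trace ((M * W)ᵀ * (M * W)) = trace (Mᵀ * M) := by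
  rw [Matrix.transpose_mul, Matrix.mul_assoc, Matrix.trace_mul_comm,
    Matrix.mul_assoc, Matrix.mul_assoc, hW.1, Matrix.mul_one]

lemma sum_sq_swap {m r : ℕ} (f : Fin m → Fin r → ℝ) :
    ∑ s, ∑ k, ∑ i, f i s * f i k = ∑ i, (∑ s, f i s) ^ 2 := by
  simp only [sq, Finset.sum_mul_sum]
  rw [Finset.sum_comm]
  rw [Finset.sum_comm (s := (Finset.univ : Finset (Fin m)))]
  rw [Finset.sum_comm]
  exact Finset.sum_congr rfl fun s _ => Finset.sum_comm

lemma frob_nonneg {a b : ℕ} (M : Matrix (Fin a) (Fin b) ℝ) : 0 ≤ frobNorm M := Real.sqrt_nonneg _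

lemma frob_sq_trace {a b : ℕ} (M : Matrix (Fin a) (Fin b) ℝ) :
    frobNorm M ^ 2 = trace (Mᵀ * M) := by
  rw [frob_sq]
  simp [trace, Matrix.mul_apply, sqn, colv, sq]

lemma trace_quad {n r : ℕ} (A : Matrix (Fin n) (Fin n) ℝ) (Z : Matrix (Fin n) (Fin r) ℝ) :
    trace (Zᵀ * A * Z) = ∑ s, colv Z s ⬝ᵥ A *ᵥ colv Z s := by
  rw [Matrix.mul_assoc]
  simp [trace, Matrix.mul_apply, colv, dotProduct, mulVec]

lemma symm_bilin {n : ℕ} {A : Matrix (Fin n) (Fin n) ℝ} (h : A.IsSymm) (x y : Fin n → ℝ) :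
    x ⬝ᵥ A *ᵥ y = y ⬝ᵥ A *ᵥ x := by
  rw [dotProduct_mulVec, dotProduct_comm, ← mulVec_transpose, h.eq]

/-- lower bound for the Gram quadratic form -/
lemma gram_lower {n r : ℕ} (Y H : Matrix (Fin n) (Fin r) ℝ) (sig : Fin r → ℝ) (c : ℝ)
    (hc : ∀ s, c ≤ sig s) (V : Matrix (Fin r) (Fin r) ℝ) (hV : IsOrthoMat V)
    (hY : Yᵀ * Y = V * Matrix.diagonal sig * Vᵀ) :
    c * frobNorm H ^ 2 ≤ ∑ s, ∑ k, (colv Y s ⬝ᵥ colv Y k) * (colv H s ⬝ᵥ colv H k) := by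
  have e1 : ∑ s, ∑ k, (colv Y s ⬝ᵥ colv Y k) * (colv H s ⬝ᵥ colv H k)
      = trace ((Yᵀ * Y) * (Hᵀ * H)) := by
    simp only [trace, Matrix.diag_apply]
    refine Finset.sum_congr rfl fun s _ => ?_
    rw [Matrix.mul_apply]
    refine Finset.sum_congr rfl fun k _ => ?_
    congr 1
    rw [dotProduct_comm]; rfl
  have e2 : trace ((Yᵀ * Y) * (Hᵀ * H)) = trace (Matrix.diagonal sig * ((H * V)ᵀ * (H * V))) := by
    rw [hY, Matrix.transpose_mul, Matrix.mul_assoc V, Matrix.mul_assoc V, Matrix.trace_mul_comm V]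
    simp only [Matrix.mul_assoc]
  have e3 : frobNorm H ^ 2 = frobNorm (H * V) ^ 2 := by
    rw [frob_sq_trace, frob_sq_trace, frob_mul_ortho _ _ hV]
  rw [e1, e2, e3, frob_sq, Finset.mul_sum]
  simp only [trace, Matrix.diag_apply, Matrix.diagonal_mul]
  refine Finset.sum_le_sum fun s _ => ?_
  have : ((H * V)ᵀ * (H * V)) s s = sqn (colv (H * V) s) := by
    rw [Matrix.mul_apply]; simp [sqn, colv, sq]
  rw [this]
  exact mul_le_mul_of_nonneg_right (hc s) (sqn_nonneg _)

/-- Givens rotation -/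
lemma givens {r : ℕ} (i j : Fin r) (hij : i ≠ j) (c s : ℝ) (hcs : c ^ 2 + s ^ 2 = 1) :
    IsOrthoMat ((1 : Matrix (Fin r) (Fin r) ℝ) + (c - 1) • (Matrix.single i i 1 + Matrix.single j j 1)
      + s • (Matrix.single i j 1 - Matrix.single j i 1)) := by
  set P : Matrix (Fin r) (Fin r) ℝ := Matrix.single i i 1 + Matrix.single j j 1 with hP
  set J : Matrix (Fin r) (Fin r) ℝ := Matrix.single i j 1 - Matrix.single j i 1 with hJ
  have hPP : P * P = P := by
    simp [hP, mul_add, add_mul, hij, hij.symm]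
  have hPJ : P * J = J := by
    simp [hP, hJ, mul_sub, add_mul, hij, hij.symm]; try abel
  have hJP : J * P = J := by
    simp [hP, hJ, mul_add, sub_mul, hij, hij.symm]; try abel
  have hJJ : J * J = -P := by
    simp [hP, hJ, mul_sub, sub_mul, hij, hij.symm]; try abel
  have hPt : Pᵀ = P := by simp [hP]
  have hJt : Jᵀ = -J := by simp [hJ]
  have key : (c - 1) + (c - 1) + (c - 1) * (c - 1) + s * s = 0 := by nlinarith
  have key' : ((c - 1) + (c - 1) + (c - 1) * (c - 1) + s * s) • P = 0 := by rw [key, zero_smul]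
  constructor
  · simp only [Matrix.transpose_add, Matrix.transpose_smul, hPt, hJt, Matrix.transpose_one]
    simp only [mul_add, add_mul, one_mul, mul_one, smul_mul_assoc, mul_smul_comm, hPP, hPJ, hJP, hJJ,
      mul_neg, smul_neg, neg_neg, smul_smul]
    refine Eq.trans ?_ ((congrArg (fun T => (1 : Matrix (Fin r) (Fin r) ℝ) + T) key').trans
      (add_zero _))
    module
  · simp only [Matrix.transpose_add, Matrix.transpose_smul, hPt, hJt, Matrix.transpose_one]
    simp only [mul_add, add_mul, one_mul, mul_one, smul_mul_assoc, mul_smul_comm, hPP, hPJ, hJP, hJJ,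
      neg_mul, smul_neg, neg_neg, smul_smul]
    refine Eq.trans ?_ ((congrArg (fun T => (1 : Matrix (Fin r) (Fin r) ℝ) + T) key').trans
      (add_zero _))
    module

lemma ortho_mul {r : ℕ} {U W : Matrix (Fin r) (Fin r) ℝ} (hU : IsOrthoMat U) (hW : IsOrthoMat W) :
    IsOrthoMat (U * W) := by
  constructor
  · rw [Matrix.transpose_mul, Matrix.mul_assoc, ← Matrix.mul_assoc W, hW.1, Matrix.one_mul, hU.1]
  · rw [Matrix.transpose_mul, Matrix.mul_assoc, ← Matrix.mul_assoc Uᵀ, hU.2, Matrix.one_mul, hW.2]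

lemma closest_trace {n r : ℕ} {Zs Z Y : Matrix (Fin n) (Fin r) ℝ} (h : IsClosest Zs Z Y)
    (W : Matrix (Fin r) (Fin r) ℝ) (hW : IsOrthoMat W) :
    trace (Zᵀ * Y * W) ≤ trace (Zᵀ * Y) := by
  obtain ⟨⟨U, hU, hYU⟩, hmin⟩ := h
  have hYU' : Y = Zs * U := hYU
  have hmem : Y * W = Zs * (U * W) := by rw [hYU', Matrix.mul_assoc]
  have h1 := hmin (Y * W) ⟨U * W, ortho_mul hU hW, hmem⟩
  have h2 := pow_le_pow_left₀ (frob_nonneg _) h1 2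
  have ex : ∀ T : Matrix (Fin n) (Fin r) ℝ, frobNorm (Z - T) ^ 2
      = trace (Zᵀ * Z) - 2 * trace (Zᵀ * T) + trace (Tᵀ * T) := by
    intro T
    rw [frob_sq_trace, Matrix.transpose_sub, Matrix.sub_mul, Matrix.mul_sub, Matrix.mul_sub]
    simp only [Matrix.trace_sub]
    have : trace (Tᵀ * Z) = trace (Zᵀ * T) := by
      rw [← Matrix.trace_transpose, Matrix.transpose_mul, Matrix.transpose_transpose]
    rw [this]; ring
  rw [ex, ex] at h2
  have e3 : trace ((Y * W)ᵀ * (Y * W)) = trace (Yᵀ * Y) := by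
    exact frob_mul_ortho _ _ hW
  rw [e3, ← Matrix.mul_assoc] at h2
  linarith

lemma closest_symm {n r : ℕ} {Zs Z Y : Matrix (Fin n) (Fin r) ℝ} (h : IsClosest Zs Z Y)
    (i j : Fin r) : (Zᵀ * Y) i j = (Zᵀ * Y) j i := by
  by_cases hij : i = j
  · rw [hij]
  set G := Zᵀ * Y with hG
  set α := G i i + G j j with hα
  set β := G j i - G i j with hβ
  have key : ∀ c s : ℝ, c ^ 2 + s ^ 2 = 1 → c * α + s * β ≤ α := by
    intro c s hcs
    have := closest_trace h _ (givens i j hij c s hcs)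
    rw [← hG] at this
    simp only [mul_add, mul_sub, Matrix.mul_one, Matrix.trace_add, mul_smul_comm, Matrix.trace_smul,
      Matrix.trace_sub, Matrix.trace_mul_single, smul_eq_mul, MulOpposite.op_one, one_smul] at this
    simp only [hα, hβ]
    linarith
  by_contra hne
  have hβ0 : β ≠ 0 := fun h0 => hne (by linarith)
  have hpos : 0 < α ^ 2 + β ^ 2 := by positivity
  set R := Real.sqrt (α ^ 2 + β ^ 2) with hR
  have hRp : 0 < R := Real.sqrt_pos.2 hpos
  have hR2 : R ^ 2 = α ^ 2 + β ^ 2 := Real.sq_sqrt hpos.le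
  have := key (α / R) (β / R) (by rw [div_pow, div_pow, ← add_div, hR2, div_self hpos.ne'])
  have h3 : α / R * α + β / R * β = R := by
    field_simp; linarith
  rw [h3] at this
  have : R ^ 2 ≤ α ^ 2 := pow_le_pow_left₀ hRp.le this 2
  have : 0 < β ^ 2 := by positivity
  linarith

/-- lower bound on the linear part via A2 -/
lemma p_lower {n r m : ℕ} (A : Fin m → Matrix (Fin n) (Fin n) ℝ) (hAsym : ∀ i, (A i).IsSymm)
    (Y H : Matrix (Fin n) (Fin r) ℝ) (c δ : ℝ) (hr : 0 < r)
    (hA2 : ∀ s k : Fin r,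
    opNorm ((1 / (m : ℝ)) •
        ∑ i, (2 : ℝ) • (A i * vecMulVec (colv Y s) (colv Y k) * A i)
      - ((2 * ((colv Y s) ⬝ᵥ colv Y k)) • (1 : Matrix (Fin n) (Fin n) ℝ)
          + (2 : ℝ) • vecMulVec (colv Y k) (colv Y s)))
      ≤ δ / r)
    (hδ : 0 < δ)
    (hgram : c * frobNorm H ^ 2 ≤ ∑ s, ∑ k, (colv Y s ⬝ᵥ colv Y k) * (colv H s ⬝ᵥ colv H k))
    (hsym : ∀ s k, colv H s ⬝ᵥ colv Y k = colv H k ⬝ᵥ colv Y s) :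
    (2 * c - δ) * frobNorm H ^ 2 ≤
      2 * ((1 / (m : ℝ)) * ∑ i, (∑ s, colv H s ⬝ᵥ A i *ᵥ colv Y s) ^ 2) := by
  have h1 : ∀ s k : Fin r, 2 * ((colv Y s ⬝ᵥ colv Y k) * (colv H s ⬝ᵥ colv H k))
      + 2 * (colv H s ⬝ᵥ colv Y k) ^ 2
      - δ / r * (Real.sqrt (sqn (colv H s)) * Real.sqrt (sqn (colv H k)))
      ≤ 2 * ((1 / (m : ℝ)) * ∑ i, (colv H s ⬝ᵥ A i *ᵥ colv Y s) * (colv H k ⬝ᵥ A i *ᵥ colv Y k)) := by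
    intro s k
    have h := (abs_le.1 (abs_bilin_le _ (colv H s) (colv H k))).1.trans' (neg_le_neg
      (mul_le_mul_of_nonneg_right (hA2 s k) (by positivity)))
    rw [Matrix.sub_mulVec, Matrix.add_mulVec, Matrix.smul_mulVec, Matrix.smul_mulVec,
      Matrix.smul_mulVec, Matrix.one_mulVec, Matrix.sum_mulVec, Matrix.vecMulVec_mulVec] at h
    simp only [dotProduct_sub, dotProduct_add, dotProduct_smul, dotProduct_sum, smul_eq_mul,
      Matrix.smul_mulVec] at h
    have e : ∀ i, colv H s ⬝ᵥ (A i * vecMulVec (colv Y s) (colv Y k) * A i) *ᵥ colv H k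
        = (colv H s ⬝ᵥ A i *ᵥ colv Y s) * (colv H k ⬝ᵥ A i *ᵥ colv Y k) := by
      intro i
      rw [← Matrix.mulVec_mulVec, ← Matrix.mulVec_mulVec, Matrix.vecMulVec_mulVec,
        symm_bilin (hAsym i) (colv H k)]
      simp [Matrix.mulVec_smul, mul_comm]
    simp only [e] at h
    rw [← Finset.mul_sum] at h
    have e2 : colv Y s ⬝ᵥ colv H k = colv H s ⬝ᵥ colv Y k := by
      rw [dotProduct_comm, hsym]
    simp only [dotProduct_smul, MulOpposite.smul_eq_mul_unop, MulOpposite.unop_op, e2] at h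
    nlinarith [h]
  have h2 := Finset.sum_le_sum fun s (_ : s ∈ Finset.univ) =>
    Finset.sum_le_sum fun k (_ : k ∈ Finset.univ) => h1 s k
  simp only [Finset.sum_sub_distrib, Finset.sum_add_distrib, ← Finset.mul_sum] at h2
  have e3 : ∑ s, ∑ k, ∑ i, (colv H s ⬝ᵥ A i *ᵥ colv Y s) * (colv H k ⬝ᵥ A i *ᵥ colv Y k)
      = ∑ i, (∑ s, colv H s ⬝ᵥ A i *ᵥ colv Y s) ^ 2 :=
    sum_sq_swap fun i s => colv H s ⬝ᵥ A i *ᵥ colv Y s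
  have e4 : ∑ s, Real.sqrt (sqn (colv H s)) * ∑ k, Real.sqrt (sqn (colv H k))
      ≤ r * frobNorm H ^ 2 := by
    rw [← Finset.sum_mul, ← sq, frob_sq]
    have := sq_sum_le_card_mul_sum_sq (s := Finset.univ) (f := fun s => Real.sqrt (sqn (colv H s)))
    simpa [Real.sq_sqrt (sqn_nonneg _)] using this
  have e5 : 0 ≤ ∑ s, ∑ k, (colv H s ⬝ᵥ colv Y k) ^ 2 :=
    Finset.sum_nonneg fun _ _ => Finset.sum_nonneg fun _ _ => sq_nonneg _
  have hr' : (0 : ℝ) < r := by exact_mod_cast hr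
  have e6 : δ / r * ∑ s, Real.sqrt (sqn (colv H s)) * ∑ k, Real.sqrt (sqn (colv H k))
      ≤ δ * frobNorm H ^ 2 := by
    calc _ ≤ δ / r * (r * frobNorm H ^ 2) := mul_le_mul_of_nonneg_left e4 (by positivity)
      _ = _ := by field_simp
  rw [← e3]
  linarith

/-- upper bound on the quadratic part via A1 -/
lemma q_upper {n r m : ℕ} (A : Fin m → Matrix (Fin n) (Fin n) ℝ)
    (H : Matrix (Fin n) (Fin r) ℝ) (δ : ℝ) (hr : 0 < r)
    (hA1 : ∀ s : Fin r,
    opNorm ((1 / (m : ℝ)) • ∑ i, (colv H s ⬝ᵥ (A i).mulVec (colv H s)) • A i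
      - (2 : ℝ) • vecMulVec (colv H s) (colv H s)) ≤ δ / r) :
    (1 / (m : ℝ)) * ∑ i, (∑ s, colv H s ⬝ᵥ A i *ᵥ colv H s) ^ 2
      ≤ 2 * (frobNorm H ^ 2) ^ 2 + δ * frobNorm H ^ 2 := by
  have h1 : ∀ s k : Fin r,
      (1 / (m : ℝ)) * ∑ i, (colv H s ⬝ᵥ A i *ᵥ colv H s) * (colv H k ⬝ᵥ A i *ᵥ colv H k)
      ≤ 2 * (sqn (colv H s) * sqn (colv H k)) + δ / r * sqn (colv H k) := by
    intro s k
    have h := (abs_le.1 (abs_bilin_le _ (colv H k) (colv H k))).2.trans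
      (mul_le_mul_of_nonneg_right (hA1 s) (by positivity))
    rw [Matrix.sub_mulVec, Matrix.smul_mulVec, Matrix.smul_mulVec,
      Matrix.sum_mulVec, Matrix.vecMulVec_mulVec] at h
    simp only [dotProduct_sub, dotProduct_smul, dotProduct_sum, smul_eq_mul,
      Matrix.smul_mulVec, MulOpposite.smul_eq_mul_unop, MulOpposite.unop_op] at h
    rw [Real.mul_self_sqrt (sqn_nonneg _), dotProduct_comm (colv H k) (colv H s)] at h
    have := dot_sq_le (colv H s) (colv H k)
    nlinarith
  have h2 := Finset.sum_le_sum fun s (_ : s ∈ Finset.univ) =>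
    Finset.sum_le_sum fun k (_ : k ∈ Finset.univ) => h1 s k
  simp only [Finset.sum_add_distrib, ← Finset.mul_sum] at h2
  have e3 : ∑ s, ∑ k, ∑ i, (colv H s ⬝ᵥ A i *ᵥ colv H s) * (colv H k ⬝ᵥ A i *ᵥ colv H k)
      = ∑ i, (∑ s, colv H s ⬝ᵥ A i *ᵥ colv H s) ^ 2 :=
    sum_sq_swap fun i s => colv H s ⬝ᵥ A i *ᵥ colv H s
  rw [← e3]
  rw [← Finset.sum_mul, ← frob_sq] at h2
  simp only [Finset.sum_const, Finset.card_univ, Fintype.card_fin, nsmul_eq_mul] at h2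
  have hr' : (0 : ℝ) < r := by exact_mod_cast hr
  have : (r : ℝ) * (δ / r * frobNorm H ^ 2) = δ * frobNorm H ^ 2 := by field_simp
  nlinarith

/-- Cauchy-Schwarz bound on the gradient -/
lemma grad_upper {n r m : ℕ} (A : Fin m → Matrix (Fin n) (Fin n) ℝ)
    (Z : Matrix (Fin n) (Fin r) ℝ) (c : Fin m → ℝ) (C : ℝ)
    (hA : (1 / (m : ℝ)) * ∑ i, (opNorm (A i)) ^ 2 ≤ C) :
    frobNorm ((1 / (m : ℝ)) • ∑ i, c i • (A i * Z)) ^ 2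
      ≤ ((1 / (m : ℝ)) * ∑ i, c i ^ 2) * (C * frobNorm Z ^ 2) := by
  have hw : (0 : ℝ) ≤ 1 / m := by positivity
  have hc0 : 0 ≤ ∑ i, c i ^ 2 := Finset.sum_nonneg fun _ _ => sq_nonneg _
  have hc : 0 ≤ (1 / (m : ℝ)) * ∑ i, c i ^ 2 := mul_nonneg hw hc0
  have hAZ : ∀ i, ∑ s, sqn (colv (A i * Z) s) ≤ opNorm (A i) ^ 2 * frobNorm Z ^ 2 := by
    intro i
    rw [frob_sq, Finset.mul_sum]
    exact Finset.sum_le_sum fun s _ => sqn_mulVec_le (A i) (colv Z s)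
  rw [frob_sq]
  have h1 : ∀ s, sqn (colv ((1 / (m : ℝ)) • ∑ i, c i • (A i * Z)) s) ≤
      ((1 / (m : ℝ)) * ∑ i, c i ^ 2) * ((1 / (m : ℝ)) * ∑ i, sqn (colv (A i * Z) s)) := by
    intro s
    simp only [sqn]
    rw [Finset.sum_comm, Finset.mul_sum (s := (Finset.univ : Finset (Fin n))),
      Finset.mul_sum (s := (Finset.univ : Finset (Fin n)))]
    refine Finset.sum_le_sum fun j _ => ?_
    have := Finset.sum_mul_sq_le_sq_mul_sq Finset.univ c (fun i => colv (A i * Z) s j)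
    have h2 := mul_le_mul_of_nonneg_left this (mul_nonneg hw hw)
    have e : colv ((1 / (m : ℝ)) • ∑ i, c i • (A i * Z)) s j
        = (1 / (m : ℝ)) * ∑ i, c i * colv (A i * Z) s j := by
      simp [colv, Matrix.sum_apply]
    rw [e]
    linarith
  have h3 := Finset.sum_le_sum fun s (_ : s ∈ Finset.univ) => h1 s
  refine h3.trans ?_
  rw [← Finset.mul_sum]
  refine mul_le_mul_of_nonneg_left ?_ hc
  rw [← Finset.mul_sum, Finset.sum_comm]
  have h4 := Finset.sum_le_sum fun i (_ : i ∈ Finset.univ) => hAZ i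
  calc _ ≤ (1 / (m : ℝ)) * ∑ i, opNorm (A i) ^ 2 * frobNorm Z ^ 2 :=
        mul_le_mul_of_nonneg_left h4 hw
    _ = ((1 / (m : ℝ)) * ∑ i, opNorm (A i) ^ 2) * frobNorm Z ^ 2 := by rw [← Finset.sum_mul]; ring
    _ ≤ C * frobNorm Z ^ 2 := mul_le_mul_of_nonneg_right hA (sq_nonneg (frobNorm Z))

theorem regularity_condition {n r m : ℕ} (hr : 0 < r)
    (A : Fin m → Matrix (Fin n) (Fin n) ℝ) (hAsym : ∀ i, (A i).IsSymm)
(Zstar : Matrix (Fin n) (Fin r) ℝ)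
    (sig : Fin r → ℝ) (hpos : ∀ s, 0 < sig s)
    (hmono : ∀ s t : Fin r, s ≤ t → sig t ≤ sig s)
    (hspec : ∃ V, IsOrthoMat V ∧ Zstarᵀ * Zstar = V * Matrix.diagonal sig * Vᵀ)
    (b : Fin m → ℝ) (hb : ∀ i, b i = Matrix.trace (A i * (Zstar * Zstarᵀ)))
    (δ : ℝ) (hδ0 : 0 < δ) (hδ : δ ≤ (sig ⟨r - 1, Nat.sub_lt hr Nat.one_pos⟩) / 16)
    (hA1 : AssumpA1 A (sig ⟨0, hr⟩) r δ)
    (hA2 : AssumpA2 A Zstar δ)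
    (hAop : (1 / (m : ℝ)) * ∑ i, (opNorm (A i)) ^ 2 ≤ 9 * n)
    (Z Zbar : Matrix (Fin n) (Fin r) ℝ)
    (hZ : dSol Z Zstar ≤ Real.sqrt (3 / 16 * (sig ⟨r - 1, Nat.sub_lt hr Nat.one_pos⟩)))
    (hZbar : IsClosest Zstar Z Zbar) :
    frobInner (gradf A b Z) (Z - Zbar) ≥
      1 / 24 * (sig ⟨r - 1, Nat.sub_lt hr Nat.one_pos⟩) * frobNorm (Z - Zbar) ^ 2
        + ((sig ⟨r - 1, Nat.sub_lt hr Nat.one_pos⟩) / (sig ⟨0, hr⟩)) * frobNorm (gradf A b Z) ^ 2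
            / (513 * n * frobNorm Zstar ^ 2) := by
  obtain ⟨V, hV, hVspec⟩ := hspec
  set σr := sig ⟨r - 1, Nat.sub_lt hr Nat.one_pos⟩ with hσr
  set σ1 := sig ⟨0, hr⟩ with hσ1
  have hσrpos : 0 < σr := hpos _
  have hσ1pos : 0 < σ1 := hpos _
  have hmin : ∀ s, σr ≤ sig s := fun s => hmono _ _ (by
    rw [Fin.le_def]; have := s.2; simp only; omega)
  have hr1 : σr ≤ σ1 := hmin _
  obtain ⟨U, hU, hYU0⟩ := hZbar.1
  have hYU : Zbar = Zstar * U := hYU0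
  set H := Z - Zbar with hH
  have hZH : Z = Zbar + H := by rw [hH]; abel
  -- norms
  have hN : frobNorm Zstar ^ 2 = ∑ s, sig s := by
    rw [frob_sq_trace, hVspec, Matrix.trace_mul_comm, ← Matrix.mul_assoc, hV.2, Matrix.one_mul,
      Matrix.trace_diagonal]
  have hNσ : σr ≤ frobNorm Zstar ^ 2 := by
    rw [hN]
    exact Finset.single_le_sum (f := sig) (fun s _ => (hpos s).le) (Finset.mem_univ _)
  have hNbar : frobNorm Zbar ^ 2 = frobNorm Zstar ^ 2 := by
    rw [frob_sq_trace, frob_sq_trace, hYU, frob_mul_ortho _ _ hU]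
  have hHd : frobNorm H ≤ Real.sqrt (3 / 16 * σr) := by
    refine le_trans ?_ hZ
    have : Nonempty (solSet Zstar) := ⟨⟨Zbar, hZbar.1⟩⟩
    exact le_ciInf fun Zt => hZbar.2 _ Zt.2
  have hH2 : frobNorm H ^ 2 ≤ 3 / 16 * σr := by
    have := pow_le_pow_left₀ (frob_nonneg _) hHd 2
    rwa [Real.sq_sqrt (by positivity)] at this
  have hHnn : 0 ≤ frobNorm H ^ 2 := sq_nonneg _
  have hZn : frobNorm Z ^ 2 ≤ 33 / 16 * frobNorm Zstar ^ 2 := by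
    have : frobNorm Z ^ 2 ≤ 3 / 2 * frobNorm Zbar ^ 2 + 3 * frobNorm H ^ 2 := by
      rw [frob_sq, frob_sq, frob_sq, Finset.mul_sum, Finset.mul_sum, ← Finset.sum_add_distrib]
      refine Finset.sum_le_sum fun s _ => ?_
      simp only [sqn]
      rw [Finset.mul_sum, Finset.mul_sum, ← Finset.sum_add_distrib]
      refine Finset.sum_le_sum fun j _ => ?_
      have : colv Z s j = colv Zbar s j + colv H s j := by
        simp only [colv]; rw [hZH]; rfl
      rw [this]
      nlinarith [sq_nonneg (colv Zbar s j - 2 * colv H s j)]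
    rw [hNbar] at this
    linarith
  have hn : 0 < n := by
    rcases Nat.eq_zero_or_pos n with h0 | h0
    · subst h0
      have : frobNorm Zstar ^ 2 = 0 := by simp [frobNorm]
      linarith
    · exact h0
  -- symmetry
  have hsym : ∀ s k, colv H s ⬝ᵥ colv Zbar k = colv H k ⬝ᵥ colv Zbar s := by
    intro s k
    have h1 := closest_symm hZbar s k
    have e : ∀ s k, colv H s ⬝ᵥ colv Zbar k = (Zᵀ * Zbar) s k - colv Zbar s ⬝ᵥ colv Zbar k := by
      intro s k
      have : colv H s = colv Z s - colv Zbar s := by rw [hH]; rfl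
      rw [this, sub_dotProduct]
      rfl
    rw [e, e, h1, dotProduct_comm (colv Zbar s)]
  have hgram := gram_lower Zbar H sig σr hmin (Uᵀ * V)
    (ortho_mul ⟨by simpa using hU.2, by simpa using hU.1⟩ hV) (by
      rw [hYU, Matrix.transpose_mul, Matrix.transpose_mul, Matrix.transpose_transpose,
        Matrix.mul_assoc, ← Matrix.mul_assoc Zstarᵀ, hVspec]
      simp only [Matrix.mul_assoc])
  have hP := p_lower A hAsym Zbar H σr δ hr (fun s k => hA2 Zbar hZbar.1 s k) hδ0 hgram hsym
  have hQ := q_upper A H δ hr (fun s => hA1 (colv H s) (by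
    apply Real.sqrt_le_sqrt
    have : sqn (colv H s) ≤ frobNorm H ^ 2 := by
      rw [frob_sq]
      exact Finset.single_le_sum (f := fun s => sqn (colv H s)) (fun s _ => sqn_nonneg _)
        (Finset.mem_univ s)
    have h2 : sqn (colv H s) ≤ σ1 := by linarith
    exact h2))
  set p : Fin m → ℝ := fun i => ∑ s, colv H s ⬝ᵥ A i *ᵥ colv Zbar s with hp
  set q : Fin m → ℝ := fun i => ∑ s, colv H s ⬝ᵥ A i *ᵥ colv H s with hq
  have hcol : ∀ s, colv Z s = colv Zbar s + colv H s := by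
    intro s; rw [hZH]; rfl
  have hc : ∀ i, Matrix.trace (Zᵀ * A i * Z) - b i = 2 * p i + q i := by
    intro i
    have hb' : b i = ∑ s, colv Zbar s ⬝ᵥ A i *ᵥ colv Zbar s := by
      rw [hb, ← trace_quad]
      have : Zstar * Zstarᵀ = Zbar * Zbarᵀ := by
        rw [hYU, Matrix.transpose_mul, Matrix.mul_assoc, ← Matrix.mul_assoc U, hU.1, Matrix.one_mul]
      rw [this, ← Matrix.mul_assoc, Matrix.trace_mul_comm, ← Matrix.mul_assoc]
    rw [hb', trace_quad, ← Finset.sum_sub_distrib]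
    simp only [hp, hq]
    rw [Finset.mul_sum, ← Finset.sum_add_distrib]
    refine Finset.sum_congr rfl fun s _ => ?_
    rw [hcol, Matrix.mulVec_add, add_dotProduct, dotProduct_add, dotProduct_add,
      symm_bilin (hAsym i) (colv Zbar s) (colv H s)]
    ring
  have hgrad : gradf A b Z = (1 / (m : ℝ)) • ∑ i, (2 * p i + q i) • (A i * Z) := by
    simp only [gradf, hc]
  have hw : (0 : ℝ) ≤ 1 / m := by positivity
  have hinner : frobInner (gradf A b Z) H = (1 / (m : ℝ)) * ∑ i, (2 * p i + q i) * (p i + q i) := by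
    have e1 : ∀ i, p i + q i = ∑ j, ∑ s, (A i * Z) j s * H j s := by
      intro i
      simp only [hp, hq]
      rw [← Finset.sum_add_distrib, Finset.sum_comm]
      refine Finset.sum_congr rfl fun s _ => ?_
      rw [← dotProduct_add, ← Matrix.mulVec_add, ← hcol, dotProduct_comm]
      rfl
    rw [hgrad]
    simp only [frobInner, e1, Matrix.smul_apply, Matrix.sum_apply, smul_eq_mul]
    simp only [Finset.mul_sum, Finset.sum_mul]
    rw [Finset.sum_comm (s := (Finset.univ : Finset (Fin m)))]
    refine Finset.sum_congr rfl fun j _ => ?_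
    rw [Finset.sum_comm (s := (Finset.univ : Finset (Fin m)))]
    refine Finset.sum_congr rfl fun s _ => Finset.sum_congr rfl fun i _ => ?_
    ring
  have hG := grad_upper A Z (fun i => 2 * p i + q i) (9 * n) hAop
  rw [← hgrad] at hG
  have hnR : (0 : ℝ) < n := by exact_mod_cast hn
  have hNpos : 0 < frobNorm Zstar ^ 2 := by linarith
  set E := (1 / (m : ℝ)) * ∑ i, (2 * p i + q i) ^ 2 with hE
  have hEnn : 0 ≤ E := mul_nonneg hw (Finset.sum_nonneg fun _ _ => sq_nonneg _)
  have hterm : (σr / σ1) * frobNorm (gradf A b Z) ^ 2 / (513 * n * frobNorm Zstar ^ 2)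
      ≤ 297 / 8208 * E := by
    rw [div_le_iff₀ (by positivity)]
    have hρ : σr / σ1 ≤ 1 := (div_le_one hσ1pos).2 hr1
    calc σr / σ1 * frobNorm (gradf A b Z) ^ 2 ≤ 1 * frobNorm (gradf A b Z) ^ 2 :=
          mul_le_mul_of_nonneg_right hρ (sq_nonneg _)
      _ ≤ E * (9 * n * frobNorm Z ^ 2) := by rw [one_mul]; exact hG
      _ ≤ E * (9 * n * (33 / 16 * frobNorm Zstar ^ 2)) := by gcongr
      _ = _ := by ring
  have hpt : (1 / (m : ℝ)) * ∑ i, (2 * p i + q i) * (p i + q i) - 297 / 8208 * E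
      ≥ 3 / 4 * ((1 / (m : ℝ)) * ∑ i, p i ^ 2) - 7 / 5 * ((1 / (m : ℝ)) * ∑ i, q i ^ 2) := by
    have : ∑ i, (3 / 4 * p i ^ 2 - 7 / 5 * q i ^ 2) ≤
        ∑ i, ((2 * p i + q i) * (p i + q i) - 297 / 8208 * (2 * p i + q i) ^ 2) := by
      refine Finset.sum_le_sum fun i _ => ?_
      nlinarith [sq_nonneg (2 * p i + 3 * q i), sq_nonneg (p i - q i)]
    have h3 := mul_le_mul_of_nonneg_left this hw
    rw [Finset.sum_sub_distrib, Finset.sum_sub_distrib, ← Finset.mul_sum, ← Finset.mul_sum,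
      ← Finset.mul_sum] at h3
    rw [hE]
    linarith
  rw [hinner]
  have hS1 : δ * frobNorm H ^ 2 ≤ σr / 16 * frobNorm H ^ 2 := mul_le_mul_of_nonneg_right hδ hHnn
  have hS2 : (frobNorm H ^ 2) ^ 2 ≤ 3 / 16 * σr * frobNorm H ^ 2 := by
    rw [sq (frobNorm H ^ 2)]; exact mul_le_mul_of_nonneg_right hH2 hHnn
  have hS3 : 0 ≤ σr * frobNorm H ^ 2 := by positivity
  nlinarith
end
end
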